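/- arXiv:1704.04751 — 8 statements merged into one kernel-verified Lean document; each statement's English description precedes it below -/
import Mathlib

section
/- Suppose F : ℕ → ℕ∞ satisfies F n ≥ 1 for every n and F tends to ⊤ (i.e., for every m : ℕ, F n > m for all sufficiently large n). Then there exists a set ℰ ⊆ 𝒩_F which is a maximal eventually different family in 𝒩_F, is a closed subset of Baire space ℕ → ℕ, and is a perfect set (nonempty, closed, and without isolated points). -/
open scoped ENat

/-- The space `𝒩_F = {g : ℕ → ℕ | ∀ n, g n < F n}`. -/
def NF (F : ℕ → ℕ∞) : Set (ℕ → ℕ) := {g | ∀ n, (g n : ℕ∞) < F n}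

/-- Two functions are eventually different. -/
def EvDiff (g₀ g₁ : ℕ → ℕ) : Prop := {n | g₀ n = g₁ n}.Finite

/-- `E` is an eventually different family in `𝒩_F`. -/
def IsEDF (F : ℕ → ℕ∞) (E : Set (ℕ → ℕ)) : Prop :=
  E ⊆ NF F ∧ ∀ g₀ ∈ E, ∀ g₁ ∈ E, g₀ ≠ g₁ → EvDiff g₀ g₁

/-- `E` is a maximal eventually different family in `𝒩_F`. -/
def IsMEDF (F : ℕ → ℕ∞) (E : Set (ℕ → ℕ)) : Prop :=
  IsEDF F E ∧ ∀ E' : Set (ℕ → ℕ), IsEDF F E' → E ⊆ E' → E' = E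

/-- An injective numerical code of the initial segment of `z` of length `j`. -/
def seqCode (z : ℕ → ℕ) : ℕ → ℕ
  | 0 => 0
  | j + 1 => Nat.pair (seqCode z j) (z j) + 1

lemma le_seqCode (z : ℕ → ℕ) (j : ℕ) : j ≤ seqCode z j := by
  induction j with
  | zero => simp
  | succ j ih =>
    have := Nat.left_le_pair (seqCode z j) (z j)
    simp only [seqCode]
    omega

lemma seqCode_congr {z z' : ℕ → ℕ} {j : ℕ} (h : ∀ i < j, z i = z' i) :
    seqCode z j = seqCode z' j := by
  induction j with
  | zero => rfl
  | succ j ih =>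
    simp only [seqCode]
    rw [ih fun i hi => h i (by omega), h j (by omega)]

lemma seqCode_inj {z z' : ℕ → ℕ} {j j' : ℕ} (h : seqCode z j = seqCode z' j') :
    j = j' ∧ ∀ i < j, z i = z' i := by
  induction j generalizing j' with
  | zero =>
    cases j' with
    | zero => simp
    | succ j' => simp [seqCode] at h
  | succ j ih =>
    cases j' with
    | zero => simp [seqCode] at h
    | succ j' =>
      simp only [seqCode, Nat.add_right_cancel_iff, Nat.pair_eq_pair] at h
      obtain ⟨rfl, h'⟩ := ih h.1
      refine ⟨rfl, fun i hi => ?_⟩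
      rcases Nat.lt_succ_iff_lt_or_eq.1 hi with hi | rfl
      · exact h' i hi
      · exact h.2

/-- The number whose mixed radix digits with respect to the bases `b` are `z 0, …, z (k - 1)`. -/
def mixedRadix (b z : ℕ → ℕ) (k : ℕ) : ℕ :=
  ∑ m ∈ Finset.range k, z m * ∏ i ∈ Finset.range m, b i

lemma mixedRadix_lt {b z : ℕ → ℕ} (hz : ∀ i, z i < b i) (k : ℕ) :
    mixedRadix b z k < ∏ i ∈ Finset.range k, b i := by
  induction k with
  | zero => simp [mixedRadix]
  | succ k ih =>
    rw [mixedRadix, Finset.sum_range_succ, Finset.prod_range_succ]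
    rw [mixedRadix] at ih
    have := Nat.mul_le_mul_left (∏ i ∈ Finset.range k, b i) (hz k)
    rw [Nat.mul_succ] at this
    rw [mul_comm (z k)]
    omega

lemma mixedRadix_eq_iff {b z z' : ℕ → ℕ} (hz : ∀ i, z i < b i) (hz' : ∀ i, z' i < b i) (k : ℕ) :
    mixedRadix b z k = mixedRadix b z' k ↔ ∀ i < k, z i = z' i := by
  refine ⟨fun h => ?_, fun h => Finset.sum_congr rfl fun i hi => by rw [h i (by simpa using hi)]⟩
  induction k with
  | zero => simp
  | succ k ih =>
    have h1 := mixedRadix_lt hz k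
    have h2 := mixedRadix_lt hz' k
    have hs : ∀ w : ℕ → ℕ, mixedRadix b w (k + 1) =
        mixedRadix b w k + (∏ i ∈ Finset.range k, b i) * w k := fun w => by
      rw [mixedRadix, Finset.sum_range_succ, mul_comm (w k), mixedRadix]
    rw [hs, hs] at h
    have hmod := congrArg (· % ∏ i ∈ Finset.range k, b i) h
    have hdiv := congrArg (· / ∏ i ∈ Finset.range k, b i) h
    simp only [Nat.add_mul_mod_self_left, Nat.mod_eq_of_lt h1, Nat.mod_eq_of_lt h2] at hmod
    simp only [Nat.add_mul_div_left _ _ (Nat.zero_lt_of_lt h1), Nat.div_eq_of_lt h1,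
      Nat.div_eq_of_lt h2, zero_add] at hdiv
    intro i hi
    rcases Nat.lt_succ_iff_lt_or_eq.1 hi with hi | rfl
    · exact ih hmod i hi
    · exact hdiv

/-- A function tending to infinity dominates `P ∘ K` for some `K` tending slowly to infinity. -/
lemma exists_slow {F : ℕ → ℕ∞} (h1 : ∀ n, 1 ≤ F n)
    (htop : ∀ m : ℕ, ∀ᶠ n in Filter.atTop, (m : ℕ∞) < F n) (P : ℕ → ℕ) (hP : P 0 = 1) :
    ∃ K : ℕ → ℕ, Monotone K ∧ (∀ m, ∃ n, m ≤ K n) ∧ (∀ n, K n ≤ n) ∧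
      ∀ n, (P (K n) : ℕ∞) ≤ F n := by
  classical
  refine ⟨fun n => Nat.findGreatest (fun k => ∀ m ≥ n, (P k : ℕ∞) ≤ F m) n, ?_, ?_, ?_, ?_⟩
  · exact fun a b hab => Nat.findGreatest_mono (fun k hk m hm => hk m (hab.trans hm)) hab
  · intro k
    obtain ⟨N, hN⟩ := Filter.eventually_atTop.1 (htop (P k))
    refine ⟨max N k, Nat.le_findGreatest (le_max_right _ _) fun m hm => ?_⟩
    exact (hN m ((le_max_left _ _).trans hm)).le
  · exact fun n => Nat.findGreatest_le n
  · intro n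
    have h0 : ∀ m ≥ n, (P 0 : ℕ∞) ≤ F m := fun m _ => by simpa [hP] using h1 m
    exact Nat.findGreatest_spec (P := fun k => ∀ m ≥ n, (P k : ℕ∞) ≤ F m)
      (Nat.zero_le n) h0 n le_rfl

/-- The pairs of a function bounded by `F'` and a set of naturals, coded by one function: the
halves form the function, the parities the set. -/
def Labelled (F' : ℕ → ℕ∞) : Set (ℕ → ℕ) := {z | ∀ n, ((z n / 2 : ℕ) : ℕ∞) < F' n}

/-- The function part of a labelled function. -/
def half (z : ℕ → ℕ) : ℕ → ℕ := fun n => z n / 2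

/-- A coding of the labelled functions by eventually different elements of `𝒩_F`, such that
along the sequence `ν` the value of the code amounts to an initial segment. -/
structure LabelCoding (F : ℕ → ℕ∞) where
  /-- The bound on the coded functions. -/
  F' : ℕ → ℕ∞
  /-- The coding function. -/
  e : (ℕ → ℕ) → ℕ → ℕ
  /-- The length of the initial segment that is coded. -/
  k : ℕ → ℕ
  /-- The sequence of the positions where the code amounts to an initial segment. -/
  ν : ℕ → ℕ
  one_le : ∀ n, 1 ≤ F' n
  le_bound : ∀ n, F' n ≤ F n
  bound_eq : ∀ i, F' (ν i) = F (ν i)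
  strictMono : StrictMono ν
  k_mono : Monotone k
  k_unbdd : ∀ m, ∃ n, m ≤ k n
  e_lt : ∀ z ∈ Labelled F', ∀ n, (e z n : ℕ∞) < F n
  e_congr : ∀ z ∈ Labelled F', ∀ z' ∈ Labelled F', ∀ n, (∀ i < n, z i = z' i) → e z n = e z' n
  e_eq_iff : ∀ z ∈ Labelled F', ∀ z' ∈ Labelled F', ∀ i,
    e z (ν i) = e z' (ν i) ↔ ∀ m < k (ν i), z m = z' m
  e_evDiff : ∀ z ∈ Labelled F', ∀ z' ∈ Labelled F', z ≠ z' → EvDiff (e z) (e z')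

namespace LabelCoding

variable {F : ℕ → ℕ∞} (D : LabelCoding F)

/-- The positions assigned to `f`; these sets are almost disjoint. -/
def pos (f : ℕ → ℕ) : Set ℕ := {n | ∃ j, n = D.ν (2 * seqCode f j)}

/-- The values of `f` at `m` and `l` come from a common code. -/
def Coh (f : ℕ → ℕ) (m l : ℕ) : Prop := ∃ y ∈ Labelled D.F', D.e y m = f m ∧ D.e y l = f l

/-- The position `m` of `f` is coherent with no later position. -/
def Terminal (f : ℕ → ℕ) (m : ℕ) : Prop :=
  m ∈ D.pos f ∧ ∀ l ∈ D.pos f, m < l → ¬ D.Coh f m l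

/-- The position `m` of `f` is coherent with no later position up to `n`. -/
def TerminalUpTo (f : ℕ → ℕ) (n m : ℕ) : Prop :=
  m ∈ D.pos f ∧ ∀ l ∈ D.pos f, m < l → l ≤ n → ¬ D.Coh f m l

/-- The criterion for using position `n`, when `c` positions below `n` have been used. -/
def Usable (z : ℕ → ℕ) (n c : ℕ) : Prop :=
  n ∈ D.pos (half z) ∧ z n % 2 = 1 ∧
    (∀ m < n, z m % 2 = 1 → D.TerminalUpTo (half z) n m) ∧
    ∀ m < c, z m % 2 = 0 → ¬ D.TerminalUpTo (half z) n m

open Classical in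
/-- The number of used positions below `n`. -/
noncomputable def usedCount (z : ℕ → ℕ) : ℕ → ℕ
  | 0 => 0
  | n + 1 => usedCount z n + if D.Usable z n (usedCount z n) then 1 else 0

/-- The positions at which the code of `z` is replaced by the function part of `z`. -/
def Used (z : ℕ → ℕ) (n : ℕ) : Prop := D.Usable z n (D.usedCount z n)

open Classical in
/-- The code of `z`, replaced by the function part of `z` at the used positions. -/
noncomputable def modify (z : ℕ → ℕ) (n : ℕ) : ℕ := if D.Used z n then z n / 2 else D.e z n

lemma mem_pos_congr {f f' : ℕ → ℕ} {n : ℕ} (h : ∀ i < n, f i = f' i) (hn : n ∈ D.pos f) :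
    n ∈ D.pos f' := by
  obtain ⟨j, rfl⟩ := hn
  refine ⟨j, ?_⟩
  rw [seqCode_congr fun i hi => h i ?_]
  have := le_seqCode f j
  have := D.strictMono.le_apply (x := 2 * seqCode f j)
  omega

lemma pos_infinite (f : ℕ → ℕ) : (D.pos f).Infinite := by
  refine (Set.infinite_range_of_injective (f := fun j => D.ν (2 * seqCode f j)) ?_).mono ?_
  · intro j j' h
    have := D.strictMono.injective h
    exact (seqCode_inj (z := f) (z' := f) (by omega)).1
  · rintro _ ⟨j, rfl⟩
    exact ⟨j, rfl⟩

lemma eq_of_infinite_pos_inter {f f' : ℕ → ℕ} (h : (D.pos f ∩ D.pos f').Infinite) : f = f' := by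
  by_contra hne
  obtain ⟨i, hi⟩ := Function.ne_iff.1 hne
  refine h (((Set.finite_Iic i).image fun j => D.ν (2 * seqCode f j)).subset ?_)
  rintro _ ⟨⟨j, rfl⟩, j', hj'⟩
  refine ⟨j, ?_, rfl⟩
  have := D.strictMono.injective hj'
  by_contra hij
  have hcode : seqCode f j = seqCode f' j' := by omega
  exact hi ((seqCode_inj hcode).2 i (by simpa using hij))

lemma terminalUpTo_congr {f f' : ℕ → ℕ} {n m : ℕ} (h : ∀ i ≤ n, f i = f' i) (hm : m ≤ n)
    (ht : D.TerminalUpTo f n m) : D.TerminalUpTo f' n m := by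
  refine ⟨D.mem_pos_congr (fun i hi => h i (by omega)) ht.1, fun l hl hml hln hc => ?_⟩
  refine ht.2 l (D.mem_pos_congr (fun i hi => (h i (by omega)).symm) hl) hml hln ?_
  rwa [Coh, h m hm, h l hln]

lemma usedCount_le (z : ℕ → ℕ) (n : ℕ) : D.usedCount z n ≤ n := by
  induction n with
  | zero => simp [usedCount]
  | succ n ih =>
    rw [usedCount]
    split_ifs <;> omega

lemma usable_congr {z z' : ℕ → ℕ} {n c : ℕ} (h : ∀ i ≤ n, z i = z' i) (hc : c ≤ n)
    (hu : D.Usable z n c) : D.Usable z' n c := by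
  have hh : ∀ i ≤ n, half z i = half z' i := fun i hi => by rw [half, half, h i hi]
  obtain ⟨hu1, hu2, hu3, hu4⟩ := hu
  refine ⟨D.mem_pos_congr (fun i hi => hh i hi.le) hu1, by rwa [← h n le_rfl], ?_, ?_⟩
  · intro m hm hz
    exact D.terminalUpTo_congr hh hm.le (hu3 m hm (by rwa [h m hm.le]))
  · intro m hm hz ht
    exact hu4 m hm (by rwa [h m (by omega)])
      (D.terminalUpTo_congr (fun i hi => (hh i hi).symm) (by omega) ht)

lemma usable_iff {z z' : ℕ → ℕ} {n c : ℕ} (h : ∀ i ≤ n, z i = z' i) (hc : c ≤ n) :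
    D.Usable z n c ↔ D.Usable z' n c :=
  ⟨D.usable_congr h hc, D.usable_congr (fun i hi => (h i hi).symm) hc⟩

lemma usedCount_congr {z z' : ℕ → ℕ} {n : ℕ} (h : ∀ i < n, z i = z' i) :
    D.usedCount z n = D.usedCount z' n := by
  classical
  induction n with
  | zero => rfl
  | succ n ih =>
    rw [usedCount, usedCount, ← ih fun i hi => h i (by omega)]
    exact congrArg _ (if_congr (D.usable_iff (fun i hi => h i (Nat.lt_succ_of_le hi))
      (D.usedCount_le z n)) rfl rfl)

lemma used_iff {z z' : ℕ → ℕ} {n : ℕ} (h : ∀ i ≤ n, z i = z' i) : D.Used z n ↔ D.Used z' n := by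
  rw [Used, Used, ← D.usedCount_congr fun i hi => h i hi.le, D.usable_iff h (D.usedCount_le z n)]

lemma modify_congr {z z' : ℕ → ℕ} (hz : z ∈ Labelled D.F') (hz' : z' ∈ Labelled D.F') {n : ℕ}
    (h : ∀ i ≤ n, z i = z' i) : D.modify z n = D.modify z' n := by
  classical
  rw [modify, modify, h n le_rfl, D.e_congr z hz z' hz' n fun i hi => h i hi.le]
  exact if_congr (D.used_iff h) rfl rfl

lemma usedCount_mono (z : ℕ → ℕ) : Monotone (D.usedCount z) :=
  monotone_nat_of_le_succ fun n => by rw [usedCount]; omega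

lemma usedCount_lt_of_used {z : ℕ → ℕ} {n m : ℕ} (hn : D.Used z n) (h : n < m) :
    D.usedCount z n < D.usedCount z m := by
  refine lt_of_lt_of_le ?_ (D.usedCount_mono z h)
  rw [usedCount, if_pos (show D.Usable z n (D.usedCount z n) from hn)]
  omega

lemma exists_lt_usedCount {z : ℕ → ℕ} (h : {n | D.Used z n}.Infinite) (c : ℕ) :
    ∃ n, c ≤ D.usedCount z n := by
  induction c with
  | zero => simp
  | succ c ih =>
    obtain ⟨n, hn⟩ := ih
    obtain ⟨m, hm, hnm⟩ := h.exists_gt n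
    exact ⟨m + 1, (hn.trans (D.usedCount_mono z hnm.le)).trans_lt
      (D.usedCount_lt_of_used hm m.lt_succ_self)⟩

/-- If infinitely many positions are used, then the labels mark the terminal positions. -/
lemma label_eq_one_iff {z : ℕ → ℕ} (h : {n | D.Used z n}.Infinite) (m : ℕ) :
    z m % 2 = 1 ↔ D.Terminal (half z) m := by
  constructor
  · intro hm
    obtain ⟨n, hn, hmn⟩ := h.exists_gt m
    refine ⟨(hn.2.2.1 m hmn hm).1, fun l hl hml => ?_⟩
    obtain ⟨n, hn, hln⟩ := h.exists_gt l
    exact (hn.2.2.1 m (hml.trans hln) hm).2 l hl hml hln.le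
  · intro hm
    by_contra h0
    obtain ⟨c, hc⟩ := D.exists_lt_usedCount h (m + 1)
    obtain ⟨n, hn, hcn⟩ := h.exists_gt c
    exact hn.2.2.2 m (hc.trans (D.usedCount_mono z hcn.le)) (by omega)
      ⟨hm.1, fun l hl hml _ => hm.2 l hl hml⟩

lemma eq_of_infinite_used {z y : ℕ → ℕ} (h : {n | D.Used z n ∧ D.Used y n}.Infinite) : z = y := by
  have hf : half z = half y :=
    D.eq_of_infinite_pos_inter (h.mono fun n hn => ⟨hn.1.1, hn.2.1⟩)
  funext m
  have h1 := D.label_eq_one_iff (h.mono fun n hn => hn.1) m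
  have h2 := D.label_eq_one_iff (h.mono fun n hn => hn.2) m
  have h3 := congrFun hf m
  rw [← hf, ← h1] at h2
  simp only [half] at h3
  omega

lemma not_coh_of_used {z : ℕ → ℕ} {n m : ℕ} (hn : D.Used z n) (hm : D.Used z m) (h : n < m) :
    ¬ D.Coh (half z) n m :=
  (hm.2.2.1 n h hn.2.1).2 m hm.1 h le_rfl

lemma finite_used_eq_code {z y : ℕ → ℕ} (hy : y ∈ Labelled D.F') :
    {n | D.Used z n ∧ z n / 2 = D.e y n}.Finite := by
  refine Set.Subsingleton.finite fun n hn m hm => ?_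
  rcases lt_trichotomy n m with h | h | h
  · exact absurd ⟨y, hy, hn.2.symm, hm.2.symm⟩ (D.not_coh_of_used hn.1 hm.1 h)
  · exact h
  · exact absurd ⟨y, hy, hm.2.symm, hn.2.symm⟩ (D.not_coh_of_used hm.1 hn.1 h)

lemma evDiff_modify {z y : ℕ → ℕ} (hz : z ∈ Labelled D.F') (hy : y ∈ Labelled D.F')
    (h : z ≠ y) : EvDiff (D.modify z) (D.modify y) := by
  have h1 : {n | D.Used z n ∧ D.Used y n}.Finite := by
    by_contra hc
    exact h (D.eq_of_infinite_used hc)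
  refine (((h1.union (D.finite_used_eq_code (z := z) hy)).union
    (D.finite_used_eq_code (z := y) hz)).union (D.e_evDiff z hz y hy h)).subset fun n hn => ?_
  simp only [Set.mem_ofPred_eq, modify] at hn
  simp only [Set.mem_union, Set.mem_ofPred_eq]
  split_ifs at hn <;> grind

lemma modify_mem {z : ℕ → ℕ} (hz : z ∈ Labelled D.F') : D.modify z ∈ NF F := by
  intro n
  rw [modify]
  split_ifs
  · exact (hz n).trans_le (D.le_bound n)
  · exact D.e_lt z hz n

lemma not_used_odd (z : ℕ → ℕ) (i : ℕ) : ¬ D.Used z (D.ν (2 * i + 1)) := by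
  rintro ⟨⟨j, hj⟩, -⟩
  have := D.strictMono.injective hj
  omega

/-- Marking the terminal positions makes infinitely many positions used, if there are infinitely
many terminal positions. -/
lemma infinite_used {z : ℕ → ℕ} (hz : ∀ m, z m % 2 = 1 ↔ D.Terminal (half z) m)
    (h : {m | D.Terminal (half z) m}.Infinite) : {n | D.Used z n}.Infinite := by
  intro hfin
  obtain ⟨N, hN⟩ := hfin.bddAbove
  have hcount : ∀ n, D.usedCount z n ≤ N + 1 := by
    intro n
    induction n with
    | zero => simp [usedCount]
    | succ n ih =>
      rw [usedCount]
      split_ifs with hu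
      · have : n ≤ N := hN hu
        have := D.usedCount_le z n
        omega
      · exact ih
  have hwit : ∀ m, ∃ M, ∀ n ≥ M, ¬ D.Terminal (half z) m → ¬ D.TerminalUpTo (half z) n m := by
    intro m
    by_cases hm : m ∈ D.pos (half z) ∧ ∃ l ∈ D.pos (half z), m < l ∧ D.Coh (half z) m l
    · obtain ⟨-, l, hl, hml, hc⟩ := hm
      exact ⟨l, fun n hn _ ht => ht.2 l hl hml hn hc⟩
    · refine ⟨0, fun n _ hnt ht => hnt ⟨ht.1, fun l hl hml hc => hm ⟨ht.1, l, hl, hml, hc⟩⟩⟩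
  choose M hM using hwit
  obtain ⟨n, hn, hgt⟩ := h.exists_gt (max N ((Finset.range (N + 1)).sup M))
  have hused : D.Used z n := by
    refine ⟨hn.1, (hz n).2 hn, fun m _ hm => ?_, fun m hm h0 => ?_⟩
    · have ht := (hz m).1 hm
      exact ⟨ht.1, fun l hl hml _ => ht.2 l hl hml⟩
    · refine hM m n ?_ fun ht => ?_
      · have : M m ≤ (Finset.range (N + 1)).sup M :=
          Finset.le_sup (Finset.mem_range.2 (hm.trans_le (hcount n)))
        exact this.trans ((le_max_right _ _).trans hgt.le)
      · have := (hz m).2 ht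
        omega
  have : n ≤ N := hN hused
  exact absurd ((le_max_left _ _).trans_lt hgt) (by omega)

/-- If there are only finitely many terminal positions, then `f` agrees with some code at
infinitely many of its positions. -/
lemma exists_code_of_finite_terminal {f : ℕ → ℕ} (h : {m | D.Terminal f m}.Finite) :
    ∃ y ∈ Labelled D.F', {n | n ∈ D.pos f ∧ D.e y n = f n}.Infinite := by
  obtain ⟨N, hN⟩ := h.bddAbove
  have hstep : ∀ p : {n // n ∈ D.pos f ∧ N < n}, ∃ q : {n // n ∈ D.pos f ∧ N < n},
      p.1 < q.1 ∧ D.Coh f p.1 q.1 := by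
    rintro ⟨n, hn, hNn⟩
    by_contra hc
    refine hNn.not_ge (hN (show D.Terminal f n from ⟨hn, fun l hl hnl hcoh => hc ?_⟩))
    exact ⟨⟨l, hl, hNn.trans hnl⟩, hnl, hcoh⟩
  choose next hlt hcoh using hstep
  obtain ⟨n₀, hn₀, hN₀⟩ := (D.pos_infinite f).exists_gt N
  let p : ℕ → {n // n ∈ D.pos f ∧ N < n} := fun i => next^[i] ⟨n₀, hn₀, hN₀⟩
  have hp : ∀ i, p (i + 1) = next (p i) := fun i => Function.iterate_succ_apply' _ _ _
  have hpmono : StrictMono fun i => (p i).1 :=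
    strictMono_nat_of_lt_succ fun i => by rw [hp]; exact hlt _
  choose y hy hy1 hy2 using fun i => hcoh (p i)
  have heq : ∀ i, ∀ m < D.k (p i).1, ∀ j ≥ i, y j m = y i m := by
    intro i m hm j hj
    induction j, hj using Nat.le_induction with
    | base => rfl
    | succ j hj ih =>
      rw [← ih]
      obtain ⟨a, ha⟩ := (p (j + 1)).2.1
      have he : D.e (y (j + 1)) (D.ν (2 * seqCode f a)) = D.e (y j) (D.ν (2 * seqCode f a)) := by
        rw [← ha, hy1, hp, hy2]
      refine (D.e_eq_iff _ (hy _) _ (hy _) _).1 he m (hm.trans_le ?_)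
      rw [← ha]
      exact D.k_mono (hpmono.monotone (by omega))
  have hidx : ∀ m, ∃ i, m < D.k (p i).1 := by
    intro m
    obtain ⟨n, hn⟩ := D.k_unbdd (m + 1)
    exact ⟨n, hn.trans (D.k_mono hpmono.le_apply)⟩
  choose ι hι using hidx
  have hlim : ∀ i, ∀ m < D.k (p i).1, y (ι m) m = y i m := by
    intro i m hm
    rcases le_total i (ι m) with h | h
    · exact heq i m hm _ h
    · exact (heq _ m (hι m) _ h).symm
  have hmem : (fun m => y (ι m) m) ∈ Labelled D.F' := fun m => hy (ι m) m
  refine ⟨_, hmem, (Set.infinite_range_of_injective hpmono.injective).mono ?_⟩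
  rintro _ ⟨i, rfl⟩
  refine ⟨(p i).2.1, ?_⟩
  rw [← hy1 i]
  obtain ⟨a, ha⟩ := (p i).2.1
  have := (D.e_eq_iff _ hmem _ (hy i) (2 * seqCode f a)).2 (by rw [← ha]; exact hlim i)
  rwa [← ha] at this

lemma exists_infinite_modify_eq {g : ℕ → ℕ} (hg : g ∈ NF F) :
    ∃ z ∈ Labelled D.F', {n | D.modify z n = g n}.Infinite := by
  classical
  let f : ℕ → ℕ := fun n => if n ∈ Set.range D.ν then g n else 0
  have hf : ∀ n, (f n : ℕ∞) < D.F' n := by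
    intro n
    simp only [f]
    split_ifs with h
    · obtain ⟨i, rfl⟩ := h
      rw [D.bound_eq]
      exact hg _
    · exact lt_of_lt_of_le (by simp) (D.one_le n)
  have hfg : ∀ n ∈ D.pos f, f n = g n := by
    rintro _ ⟨j, rfl⟩
    simp [f]
  by_cases hT : {m | D.Terminal f m}.Finite
  · obtain ⟨y, hy, hinf⟩ := D.exists_code_of_finite_terminal hT
    refine ⟨y, hy, ?_⟩
    by_cases hyf : half y = f
    · refine hinf.mono fun n hn => ?_
      rw [Set.mem_ofPred_eq, ← hfg n hn.1, modify]
      split_ifs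
      · exact congrFun hyf n
      · exact hn.2
    · have hfin : (D.pos (half y) ∩ D.pos f).Finite := by
        by_contra hc
        exact hyf (D.eq_of_infinite_pos_inter hc)
      refine (hinf.sdiff hfin).mono fun n hn => ?_
      have hu : ¬ D.Used y n := fun hu => hn.2 ⟨hu.1, hn.1.1⟩
      rw [Set.mem_ofPred_eq, modify, if_neg hu, hn.1.2, hfg n hn.1.1]
  · let z : ℕ → ℕ := fun n => 2 * f n + if D.Terminal f n then 1 else 0
    have hz : half z = f := by
      funext n
      simp only [half, z]
      split_ifs <;> omega
    have hzt : ∀ m, z m % 2 = 1 ↔ D.Terminal (half z) m := by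
      intro m
      rw [hz]
      simp only [z]
      split_ifs with h <;> simp [h]
    refine ⟨z, fun n => ?_, ?_⟩
    · have := congrFun hz n
      simp only [half] at this
      rw [this]
      exact hf n
    · refine (D.infinite_used hzt (by rwa [hz])).mono fun n hn => ?_
      rw [Set.mem_ofPred_eq, modify, if_pos (show D.Used z n from hn), ← hfg n (hz ▸ hn.1)]
      exact congrFun hz n

lemma isMEDF : IsMEDF F (D.modify '' Labelled D.F') := by
  refine ⟨⟨?_, ?_⟩, fun E' hE' hsub => (Set.Subset.antisymm hsub fun g hg => ?_).symm⟩
  · rintro _ ⟨z, hz, rfl⟩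
    exact D.modify_mem hz
  · rintro _ ⟨z, hz, rfl⟩ _ ⟨y, hy, rfl⟩ hne
    exact D.evDiff_modify hz hy fun h => hne (by rw [h])
  · obtain ⟨z, hz, hinf⟩ := D.exists_infinite_modify_eq (hE'.1 hg)
    by_contra hgE
    refine hinf (hE'.2 _ (hsub ⟨z, hz, rfl⟩) g hg ?_)
    rintro rfl
    exact hgE ⟨z, hz, rfl⟩

end LabelCoding

/-- Basic neighbourhoods in Baire space are given by initial segments. -/
lemma exists_initial_segment_subset {φ : ℕ → ℕ} {U : Set (ℕ → ℕ)} (hU : U ∈ nhds φ) :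
    ∃ N, ∀ ψ : ℕ → ℕ, (∀ i < N, ψ i = φ i) → ψ ∈ U := by
  rw [nhds_pi, Filter.mem_pi] at hU
  obtain ⟨I, hI, t, ht, hsub⟩ := hU
  obtain ⟨N, hN⟩ := hI.bddAbove
  refine ⟨N + 1, fun ψ hψ => hsub fun i hi => ?_⟩
  rw [hψ i (Nat.lt_succ_of_le (hN hi))]
  exact mem_of_mem_nhds (ht i)

lemma initial_segment_mem_nhds (φ : ℕ → ℕ) (N : ℕ) :
    {ψ : ℕ → ℕ | ∀ i < N, ψ i = φ i} ∈ nhds φ := by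
  have : {ψ : ℕ → ℕ | ∀ i < N, ψ i = φ i} = (Set.Iio N).pi fun i => {φ i} := by
    ext ψ
    simp [Set.mem_pi]
  rw [this]
  exact set_pi_mem_nhds (Set.finite_Iio N) fun i _ => by simp

namespace LabelCoding

variable {F : ℕ → ℕ∞} (D : LabelCoding F)

lemma isClosed_image_modify : IsClosed (D.modify '' Labelled D.F') := by
  refine isClosed_of_closure_subset fun φ hφ => ?_
  have happrox : ∀ N, ∃ z ∈ Labelled D.F', ∀ i < N, D.modify z i = φ i := by
    intro N
    obtain ⟨_, h, z, hz, rfl⟩ := mem_closure_iff_nhds.1 hφ _ (initial_segment_mem_nhds φ N)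
    exact ⟨z, hz, h⟩
  choose z hz hzφ using happrox
  have hidx : ∀ m, ∃ i, m < D.k (D.ν (2 * i + 1)) := by
    intro m
    obtain ⟨n, hn⟩ := D.k_unbdd (m + 1)
    exact ⟨n, hn.trans (D.k_mono (le_trans (by omega) D.strictMono.le_apply))⟩
  choose ι hι using hidx
  let s : ℕ → ℕ := fun m => D.ν (2 * ι m + 1) + 1
  have hstab : ∀ m, ∀ N ≥ s m, z N m = z (s m) m := by
    intro m N hN
    have he : ∀ N ≥ s m, D.e (z N) (D.ν (2 * ι m + 1)) = φ (D.ν (2 * ι m + 1)) := by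
      intro N hN
      have h := hzφ N (D.ν (2 * ι m + 1)) hN
      rwa [modify, if_neg (D.not_used_odd _ _)] at h
    exact (D.e_eq_iff _ (hz N) _ (hz (s m)) _).1
      ((he N hN).trans (he (s m) le_rfl).symm) m (hι m)
  have hmem : (fun m => z (s m) m) ∈ Labelled D.F' := fun m => hz (s m) m
  refine ⟨_, hmem, funext fun n => ?_⟩
  let N := max (n + 1) ((Finset.range (n + 1)).sup s)
  rw [← hzφ N n (lt_of_lt_of_le n.lt_succ_self (le_max_left _ _))]
  refine D.modify_congr hmem (hz N) fun i hi => (hstab i N ?_).symm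
  exact (Finset.le_sup (f := s) (Finset.mem_range.2 (Nat.lt_succ_of_le hi))).trans (le_max_right _ _)

lemma perfect_image_modify : Perfect (D.modify '' Labelled D.F') := by
  refine ⟨D.isClosed_image_modify, ?_⟩
  rintro _ ⟨z, hz, rfl⟩
  rw [accPt_iff_nhds]
  intro U hU
  obtain ⟨N, hN⟩ := exists_initial_segment_subset hU
  let z' : ℕ → ℕ := Function.update z N (2 * (z N / 2) + (1 - z N % 2))
  have hne : z' ≠ z := fun h => by
    have := congrFun h N
    simp only [z', Function.update_self] at this
    omega
  have hz' : z' ∈ Labelled D.F' := by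
    intro n
    by_cases hn : n = N
    · subst hn
      have : z' n / 2 = z n / 2 := by
        simp only [z', Function.update_self]
        omega
      rw [this]
      exact hz n
    · simp only [z', Function.update_of_ne hn]
      exact hz n
  refine ⟨D.modify z', ⟨hN _ fun i hi => ?_, z', hz', rfl⟩, fun h => ?_⟩
  · refine D.modify_congr hz' hz fun j hj => ?_
    exact Function.update_of_ne (by omega) _ _
  · have hd := D.evDiff_modify hz' hz hne
    rw [h] at hd
    exact Set.infinite_univ (by simpa [EvDiff] using hd)

lemma nonempty_image_modify : (D.modify '' Labelled D.F').Nonempty :=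
  ⟨_, fun _ => 0, fun n => lt_of_lt_of_le (by simp) (D.one_le n), rfl⟩

end LabelCoding

lemma evDiff_of_eq_imp {g g' z z' : ℕ → ℕ} {K : ℕ → ℕ} (hK : Monotone K) (hK' : ∀ m, ∃ n, m ≤ K n)
    (hne : z ≠ z') (h : ∀ n, g n = g' n → ∀ i < K n, z i = z' i) : EvDiff g g' := by
  obtain ⟨i, hi⟩ := Function.ne_iff.1 hne
  obtain ⟨N, hN⟩ := hK' (i + 1)
  refine (Set.finite_Iio N).subset fun n hn => ?_
  by_contra hc
  exact hi (h n hn i (hN.trans (hK (by simpa using hc))))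

lemma exists_strictMono_forall {p : ℕ → Prop} (h : {n | p n}.Infinite) :
    ∃ ν : ℕ → ℕ, StrictMono ν ∧ ∀ i, p (ν i) :=
  Filter.extraction_of_frequently_atTop (Nat.frequently_atTop_iff_infinite.2 h)

/-- The characteristic function of the graph of `z`. -/
def graphBits (z : ℕ → ℕ) (m : ℕ) : ℕ := if z m.unpair.1 = m.unpair.2 then 1 else 0

lemma graphBits_lt (z : ℕ → ℕ) (m : ℕ) : graphBits z m < 2 := by
  rw [graphBits]
  split_ifs <;> omega

lemma graphBits_injective : Function.Injective graphBits := by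
  intro z z' h
  funext i
  have := congrFun h (Nat.pair i (z i))
  simp only [graphBits, Nat.unpair_pair, if_true] at this
  split_ifs at this with h'
  exact h'.symm

lemma nonempty_labelCoding_of_infinite {F : ℕ → ℕ∞} (h1 : ∀ n, 1 ≤ F n)
    (htop : ∀ m : ℕ, ∀ᶠ n in Filter.atTop, (m : ℕ∞) < F n) (hI : {n | F n = ⊤}.Infinite) :
    Nonempty (LabelCoding F) := by
  classical
  obtain ⟨ν, hν, hνI⟩ := exists_strictMono_forall hI
  obtain ⟨K, hK1, hK2, hK3, hK4⟩ :=
    exists_slow h1 htop (fun k => ∏ _i ∈ Finset.range k, 2) (by simp)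
  exact ⟨{
    F' := F
    e := fun z n => if F n = ⊤ then seqCode z n else mixedRadix (fun _ => 2) (graphBits z) (K n)
    k := id
    ν := ν
    one_le := h1
    le_bound := fun _ => le_rfl
    bound_eq := fun _ => rfl
    strictMono := hν
    k_mono := monotone_id
    k_unbdd := fun m => ⟨m, le_rfl⟩
    e_lt := fun z _ n => by
      split_ifs with h
      · rw [h]
        exact ENat.natCast_lt_top _
      · exact lt_of_lt_of_le (by exact_mod_cast mixedRadix_lt (graphBits_lt z) (K n)) (hK4 n)
    e_congr := fun z _ z' _ n h => by
      split_ifs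
      · exact seqCode_congr h
      · refine (mixedRadix_eq_iff (graphBits_lt z) (graphBits_lt z') _).2 fun i hi => ?_
        rw [graphBits, graphBits,
          h _ ((Nat.unpair_left_le i).trans_lt (hi.trans_le (hK3 n)))]
    e_eq_iff := fun z _ z' _ i => by
      simp only [hνI i, if_true]
      exact ⟨fun h => (seqCode_inj h).2, seqCode_congr⟩
    e_evDiff := fun z _ z' _ hne => by
      have hA := evDiff_of_eq_imp (g := seqCode z) (g' := seqCode z') monotone_id
        (fun m => ⟨m, le_rfl⟩) hne fun n h => (seqCode_inj h).2
      have hB := evDiff_of_eq_imp (g := fun n => mixedRadix (fun _ => 2) (graphBits z) (K n))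
        (g' := fun n => mixedRadix (fun _ => 2) (graphBits z') (K n)) hK1 hK2
        (graphBits_injective.ne hne)
        fun n h => (mixedRadix_eq_iff (graphBits_lt z) (graphBits_lt z') _).1 h
      refine (hA.union hB).subset fun n hn => ?_
      simp only [Set.mem_ofPred_eq] at hn
      split_ifs at hn
      · exact Or.inl hn
      · exact Or.inr hn }⟩

lemma nonempty_labelCoding_of_finite {F : ℕ → ℕ∞} (h1 : ∀ n, 1 ≤ F n)
    (htop : ∀ m : ℕ, ∀ᶠ n in Filter.atTop, (m : ℕ∞) < F n) (hI : {n | F n ≠ ⊤}.Infinite) :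
    Nonempty (LabelCoding F) := by
  classical
  obtain ⟨ν, hν, hνI⟩ := exists_strictMono_forall hI
  let F' : ℕ → ℕ∞ := fun n => if F n = ⊤ then 1 else F n
  have hF' : ∀ n, F' n ≠ ⊤ := fun n => by
    simp only [F']
    split_ifs with h
    · exact ENat.one_ne_top
    · exact h
  let b : ℕ → ℕ := fun n => 2 * (F' n).toNat
  have hb : ∀ z ∈ Labelled F', ∀ n, z n < b n := by
    intro z hz n
    have h := hz n
    rw [← ENat.natCast_toNat (hF' n), Nat.cast_lt] at h
    simp only [b]
    omega
  obtain ⟨K, hK1, hK2, hK3, hK4⟩ :=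
    exists_slow h1 htop (fun k => ∏ i ∈ Finset.range k, b i) (by simp)
  exact ⟨{
    F' := F'
    e := fun z n => mixedRadix b z (K n)
    k := K
    ν := ν
    one_le := fun n => by
      simp only [F']
      split_ifs
      · exact le_rfl
      · exact h1 n
    le_bound := fun n => by
      simp only [F']
      split_ifs
      · exact h1 n
      · exact le_rfl
    bound_eq := fun i => if_neg (hνI i)
    strictMono := hν
    k_mono := hK1
    k_unbdd := hK2
    e_lt := fun z hz n =>
      lt_of_lt_of_le (by exact_mod_cast mixedRadix_lt (hb z hz) (K n)) (hK4 n)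
    e_congr := fun z hz z' hz' n h =>
      (mixedRadix_eq_iff (hb z hz) (hb z' hz') _).2 fun i hi => h i (hi.trans_le (hK3 n))
    e_eq_iff := fun z hz z' hz' i => mixedRadix_eq_iff (hb z hz) (hb z' hz') _
    e_evDiff := fun z hz z' hz' hne => evDiff_of_eq_imp hK1 hK2 hne
      fun n h => (mixedRadix_eq_iff (hb z hz) (hb z' hz') _).1 h }⟩

lemma nonempty_labelCoding {F : ℕ → ℕ∞} (h1 : ∀ n, 1 ≤ F n)
    (htop : ∀ m : ℕ, ∀ᶠ n in Filter.atTop, (m : ℕ∞) < F n) : Nonempty (LabelCoding F) := by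
  by_cases hI : {n | F n = ⊤}.Infinite
  · exact nonempty_labelCoding_of_infinite h1 htop hI
  · exact nonempty_labelCoding_of_finite h1 htop (Set.not_infinite.1 hI).infinite_compl

theorem stmt0 (F : ℕ → ℕ∞) (h1 : ∀ n, 1 ≤ F n)
    (htop : ∀ m : ℕ, ∀ᶠ n in Filter.atTop, (m : ℕ∞) < F n) :
    ∃ E : Set (ℕ → ℕ), IsMEDF F E ∧ IsClosed E ∧ Perfect E ∧ E.Nonempty := by
  obtain ⟨D⟩ := nonempty_labelCoding h1 htop
  exact ⟨_, D.isMEDF, D.isClosed_image_modify, D.perfect_image_modify, D.nonempty_image_modify⟩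
end

section
/- There exists a set ℰ ⊆ ℕ → ℕ which is a maximal eventually different family in Baire space, is closed in the product topology on ℕ → ℕ, and is a perfect set (nonempty, closed, and without isolated points). -/
/-- `E` is an eventually different family in Baire space. -/
def IsEDFBaire (E : Set (ℕ → ℕ)) : Prop :=
  ∀ g₀ ∈ E, ∀ g₁ ∈ E, g₀ ≠ g₁ → EvDiff g₀ g₁

/-- `E` is a maximal eventually different family in Baire space. -/
def IsMEDFBaire (E : Set (ℕ → ℕ)) : Prop :=
  IsEDFBaire E ∧ ∀ E' : Set (ℕ → ℕ), IsEDFBaire E' → E ⊆ E' → E' = E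

namespace ClosedMED

/-- The code of the restriction of `f` to `{0, …, n - 1}`. -/
def code (f : ℕ → ℕ) (n : ℕ) : ℕ :=
  Encodable.encode (List.ofFn fun i : Fin n => f i)

lemma code_eq_iff {f g : ℕ → ℕ} {n m : ℕ} :
    code f n = code g m ↔ n = m ∧ ∀ i < n, f i = g i := by
  rw [code, code, Encodable.encode_inj]
  constructor
  · intro h
    have hlen := congrArg List.length h
    simp only [List.length_ofFn] at hlen
    subst hlen
    exact ⟨rfl, fun i hi => congrFun (List.ofFn_injective h) ⟨i, hi⟩⟩
  · rintro ⟨rfl, h⟩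
    exact congrArg List.ofFn (funext fun i => h i i.2)

lemma le_code (f : ℕ → ℕ) (n : ℕ) : n ≤ code f n := by
  simpa [code] using Encodable.length_le_encode (List.ofFn fun i : Fin n => f i)

lemma code_injective (f : ℕ → ℕ) : Function.Injective (code f) :=
  fun _ _ h => (code_eq_iff.1 h).1

lemma finite_range_code_inter {f g : ℕ → ℕ} (h : f ≠ g) :
    (Set.range (code f) ∩ Set.range (code g)).Finite := by
  obtain ⟨i, hi⟩ := Function.ne_iff.1 h
  refine ((Set.finite_Iic i).image (code f)).subset ?_
  rintro _ ⟨⟨k, rfl⟩, l, hl⟩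
  obtain ⟨rfl, hagree⟩ := code_eq_iff.1 hl
  refine ⟨l, ?_, rfl⟩
  by_contra hlt
  exact hi (hagree i (not_le.1 hlt)).symm

lemma mem_range_code_of_agree {f g : ℕ → ℕ} {m : ℕ} (h : ∀ i < m, f i = g i)
    (hm : m ∈ Set.range (code f)) : m ∈ Set.range (code g) := by
  obtain ⟨k, rfl⟩ := hm
  exact ⟨k, code_eq_iff.2 ⟨rfl, fun i hi => (h i (hi.trans_le (le_code f k))).symm⟩⟩

/-- At the odd places given by `j < m`, the function `f` takes as values the codes of two
initial segments, of lengths `j` and `m`, of one function, and `m` codes an initial segment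
of `f`. -/
def Extends (f : ℕ → ℕ) (j m : ℕ) : Prop :=
  j < m ∧ m ∈ Set.range (code f) ∧
    ∃ h : ℕ → ℕ, f (2 * j + 1) = code h j ∧ f (2 * m + 1) = code h m

lemma Extends.congr {f g : ℕ → ℕ} {j m : ℕ} (h : Extends f j m)
    (hfg : ∀ i < 2 * m + 2, f i = g i) : Extends g j m := by
  obtain ⟨hjm, hm, u, hj, hu⟩ := h
  exact ⟨hjm, mem_range_code_of_agree (fun i hi => hfg i (by lia)) hm, u,
    by rw [← hfg _ (by lia), hj], by rw [← hfg _ (by lia), hu]⟩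

/-- The least `m` with `Extends f j m`, or `0` if there is none. -/
noncomputable def witness (f : ℕ → ℕ) (j : ℕ) : ℕ := sInf {m | Extends f j m}

lemma witness_le {f : ℕ → ℕ} {j m : ℕ} (h : Extends f j m) : witness f j ≤ m :=
  Nat.sInf_le h

lemma extends_witness {f : ℕ → ℕ} {j m : ℕ} (h : Extends f j m) :
    Extends f j (witness f j) :=
  Nat.sInf_mem (s := {m | Extends f j m}) ⟨m, h⟩

lemma witness_eq_zero_iff {f : ℕ → ℕ} {j : ℕ} :
    witness f j = 0 ↔ ∀ m, ¬ Extends f j m := by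
  constructor
  · intro h m hm
    have := (extends_witness hm).1
    lia
  · intro h
    simp [witness, h]

lemma extends_witness_of_ne_zero {f : ℕ → ℕ} {j : ℕ} (h : witness f j ≠ 0) :
    Extends f j (witness f j) := by
  rw [Ne, witness_eq_zero_iff] at h
  push Not at h
  exact extends_witness h.choose_spec

lemma witness_congr {f g : ℕ → ℕ} {j : ℕ}
    (hfg : Extends f j (witness f j) → Extends g j (witness f j))
    (hgf : ∀ m, Extends g j m → ∃ m' ≤ m, Extends f j m') :
    witness f j = witness g j := by
  by_cases h : witness f j = 0
  · rw [h, eq_comm, witness_eq_zero_iff]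
    intro m hm
    obtain ⟨m', -, hm'⟩ := hgf m hm
    exact witness_eq_zero_iff.1 h m' hm'
  · have hg := hfg (extends_witness_of_ne_zero h)
    obtain ⟨m', hle, hm'⟩ := hgf _ (extends_witness hg)
    exact le_antisymm ((witness_le hm').trans hle) (witness_le hg)

/-- The places where the member of the family attached to `f` copies `f`: those `j` which code
an initial segment of `f` and for which `Extends f j m` fails for every `m`. -/
def Terminal (f : ℕ → ℕ) (j : ℕ) : Prop :=
  j ∈ Set.range (code f) ∧ witness f j = 0

open Classical in
/-- The member of the maximal eventually different family attached to `f`. -/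
noncomputable def member (f : ℕ → ℕ) (n : ℕ) : ℕ :=
  if Even n then code (fun i => Nat.pair (f i) (witness f i)) (n / 2)
  else if Terminal f (n / 2) then f n else code f (n / 2)

lemma member_even (f : ℕ → ℕ) (k : ℕ) :
    member f (2 * k) = code (fun i => Nat.pair (f i) (witness f i)) k := by
  simp [member]

lemma odd_div_two (j : ℕ) : (2 * j + 1) / 2 = j := by lia

lemma member_odd_of_terminal {f : ℕ → ℕ} {j : ℕ} (h : Terminal f j) :
    member f (2 * j + 1) = f (2 * j + 1) := by
  simp [member, odd_div_two, h]

lemma member_odd_of_not_terminal {f : ℕ → ℕ} {j : ℕ} (h : ¬ Terminal f j) :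
    member f (2 * j + 1) = code f j := by
  simp [member, odd_div_two, h]

lemma member_even_eq_iff {f g : ℕ → ℕ} {k : ℕ} :
    member f (2 * k) = member g (2 * k) ↔
      ∀ i < k, f i = g i ∧ witness f i = witness g i := by
  simp [member_even, code_eq_iff, Nat.pair_eq_pair]

lemma member_congr {f g : ℕ → ℕ} {n : ℕ} (h : ∀ i ≤ n, f i = g i)
    (hw : ∀ i ≤ n, witness f i = witness g i) : member f n = member g n := by
  obtain ⟨k, rfl | rfl⟩ := Nat.even_or_odd' n
  · exact member_even_eq_iff.2 fun i hi => ⟨h i (by lia), hw i (by lia)⟩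
  · have hT : Terminal f k ↔ Terminal g k := by
      refine and_congr ⟨mem_range_code_of_agree fun i hi => h i (by lia),
        mem_range_code_of_agree fun i hi => (h i (by lia)).symm⟩ ?_
      rw [hw k (by lia)]
    by_cases hf : Terminal f k
    · rw [member_odd_of_terminal hf, member_odd_of_terminal (hT.1 hf), h _ le_rfl]
    · rw [member_odd_of_not_terminal hf, member_odd_of_not_terminal (mt hT.2 hf), code_eq_iff]
      exact ⟨rfl, fun i hi => h i (by lia)⟩

lemma subsingleton_terminal_inter_code (f g : ℕ → ℕ) :
    {j | Terminal f j ∧ f (2 * j + 1) = code g j}.Subsingleton := by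
  have key : ∀ j m, j < m → Terminal f j → Terminal f m → f (2 * j + 1) = code g j →
      f (2 * m + 1) ≠ code g m := fun j m hjm hj hm hgj hgm =>
    witness_eq_zero_iff.1 hj.2 m ⟨hjm, hm.1, g, hgj, hgm⟩
  rintro j ⟨hj, hgj⟩ m ⟨hm, hgm⟩
  rcases lt_trichotomy j m with h | h | h
  · exact absurd hgm (key j m h hj hm hgj)
  · exact h
  · exact absurd hgj (key m j h hm hj hgm)

lemma evDiff_member {f g : ℕ → ℕ} (h : f ≠ g) : EvDiff (member f) (member g) := by
  obtain ⟨i, hi⟩ := Function.ne_iff.1 h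
  have hfin := ((finite_range_code_inter h).union
    ((subsingleton_terminal_inter_code f g).finite.union
      (subsingleton_terminal_inter_code g f).finite)).image (2 * · + 1)
  refine ((Set.finite_Iio (2 * i + 2)).union hfin).subset ?_
  intro n hn
  change member f n = member g n at hn
  by_cases hlt : n < 2 * i + 2
  · exact Or.inl hlt
  right
  obtain ⟨k, rfl | rfl⟩ := Nat.even_or_odd' n
  · exact absurd (member_even_eq_iff.1 hn i (by lia)).1 hi
  refine ⟨k, ?_, rfl⟩
  by_cases hf : Terminal f k <;> by_cases hg : Terminal g k
  · exact Or.inl ⟨hf.1, hg.1⟩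
  · rw [member_odd_of_terminal hf, member_odd_of_not_terminal hg] at hn
    exact Or.inr (Or.inl ⟨hf, hn⟩)
  · rw [member_odd_of_not_terminal hf, member_odd_of_terminal hg] at hn
    exact Or.inr (Or.inr ⟨hg, hn.symm⟩)
  · rw [member_odd_of_not_terminal hf, member_odd_of_not_terminal hg, code_eq_iff] at hn
    exact absurd (hn.2 i (by lia)) hi

lemma not_evDiff_self (f : ℕ → ℕ) : ¬ EvDiff f f := by
  simpa [EvDiff] using Set.infinite_univ (α := ℕ)

lemma member_injective : Function.Injective member := by
  intro f g h
  by_contra hne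
  have := evDiff_member hne
  rw [h] at this
  exact not_evDiff_self _ this

/-- If consecutive terms of a sequence are related by `Extends g`, all the coded initial segments
come from one function. -/
lemma exists_code_of_extends {g : ℕ → ℕ} {j : ℕ → ℕ}
    (hj : ∀ n, Extends g (j n) (j (n + 1))) :
    ∃ h : ℕ → ℕ, ∀ n, g (2 * j n + 1) = code h (j n) := by
  have hmono : StrictMono j := strictMono_nat_of_lt_succ fun n => (hj n).1
  choose u hu hu' using fun n => (hj n).2.2
  have hagree : ∀ n k, ∀ i < j (n + 1), u n i = u (n + k) i := by
    intro n k
    induction k with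
    | zero => simp
    | succ k ih =>
      intro i hi
      rw [ih i hi]
      have := code_eq_iff.1 ((hu' (n + k)).symm.trans (hu (n + k + 1)))
      exact this.2 i (hi.trans_le (hmono.monotone (by lia)))
  refine ⟨fun i => u i i, fun n => ?_⟩
  rw [hu n, code_eq_iff]
  refine ⟨rfl, fun i hi => ?_⟩
  rcases le_total i n with hin | hni
  · obtain ⟨k, rfl⟩ := Nat.exists_eq_add_of_le hin
    exact (hagree i k i (hmono.le_apply (x := i + 1))).symm
  · obtain ⟨k, rfl⟩ := Nat.exists_eq_add_of_le hni
    exact hagree n k _ (hi.trans (hmono (Nat.lt_succ_self n)))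

lemma exists_not_evDiff_member (g : ℕ → ℕ) : ∃ f, ¬ EvDiff (member f) g := by
  have hodd : Function.Injective fun j : ℕ => 2 * j + 1 := fun a b h => by
    simpa using h
  by_cases hT : {j | Terminal g j}.Finite
  swap
  · refine ⟨g, fun hfin => hT ((hfin.preimage hodd.injOn).subset ?_)⟩
    exact fun j hj => member_odd_of_terminal hj
  obtain ⟨b, hb⟩ := hT.bddAbove
  have hstep : ∀ j : {j // j ∈ Set.range (code g) ∧ b < j},
      ∃ m : {j // j ∈ Set.range (code g) ∧ b < j}, Extends g j m := by
    rintro ⟨j, hj, hbj⟩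
    have hw : witness g j ≠ 0 := fun hw => (hb (show Terminal g j from ⟨hj, hw⟩)).not_gt hbj
    have hext := extends_witness_of_ne_zero hw
    exact ⟨⟨_, hext.2.1, hbj.trans hext.1⟩, hext⟩
  choose next hnext using hstep
  let start : {j // j ∈ Set.range (code g) ∧ b < j} :=
    ⟨code g (b + 1), ⟨_, rfl⟩, le_code g (b + 1)⟩
  let s : ℕ → {j // j ∈ Set.range (code g) ∧ b < j} := fun n => next^[n] start
  have hs : ∀ n, Extends g (s n) (s (n + 1)) := fun n => by
    simpa only [s, Function.iterate_succ_apply'] using hnext (s n)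
  obtain ⟨h, hh⟩ := exists_code_of_extends hs
  have hinj : Function.Injective fun n => (s n : ℕ) :=
    (strictMono_nat_of_lt_succ fun n => (hs n).1).injective
  have hTh : {n | Terminal h (s n)}.Finite := by
    by_cases hgh : g = h
    · subst hgh
      exact hT.preimage hinj.injOn
    · exact ((finite_range_code_inter hgh).preimage hinj.injOn).subset
        fun n hn => ⟨(s n).2.1, hn.1⟩
  refine ⟨h, fun hfin => ?_⟩
  have hagree := hfin.preimage (hodd.comp hinj).injOn
  refine Set.infinite_univ ((hTh.union hagree).subset fun n _ => ?_)
  by_cases hn : Terminal h (s n)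
  · exact Or.inl hn
  · exact Or.inr ((member_odd_of_not_terminal hn).trans (hh n).symm)

lemma isMEDFBaire_range_member : IsMEDFBaire (Set.range member) := by
  constructor
  · rintro _ ⟨f, rfl⟩ _ ⟨g, rfl⟩ hne
    exact evDiff_member fun h => hne (h ▸ rfl)
  · intro E hE hsub
    refine (hsub.antisymm fun g hg => ?_).symm
    obtain ⟨f, hf⟩ := exists_not_evDiff_member g
    by_contra hne
    exact hf (hE _ (hsub ⟨f, rfl⟩) _ hg fun h => hne ⟨f, h⟩)

lemma isClosed_range_member : IsClosed (Set.range member) := by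
  refine isClosed_of_closure_subset fun g hg => ?_
  have happrox : ∀ n, ∃ f, ∀ i < n, member f i = g i := by
    intro n
    obtain ⟨_, hy, f, rfl⟩ := mem_closure_iff.1 hg _
      (PiNat.isOpen_cylinder (fun _ => ℕ) g n) (PiNat.self_mem_cylinder g n)
    exact ⟨f, PiNat.mem_cylinder_iff.1 hy⟩
  choose f hf using happrox
  let F : ℕ → ℕ := fun i => f (2 * i + 3) i
  have hstable : ∀ i n, 2 * i + 3 ≤ n →
      f n i = F i ∧ witness (f n) i = witness (f (2 * i + 3)) i := by
    intro i n hn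
    have h : member (f n) (2 * (i + 1)) = member (f (2 * i + 3)) (2 * (i + 1)) := by
      rw [hf n _ (by lia), hf (2 * i + 3) _ (by lia)]
    exact member_even_eq_iff.1 h i (Nat.lt_succ_self i)
  have hw : ∀ i, witness (f (2 * i + 3)) i = witness F i := by
    intro i
    set c := witness (f (2 * i + 3)) i with hc
    have hcn : ∀ n, 2 * i + 3 ≤ n → witness (f n) i = c := fun n hn => (hstable i n hn).2
    by_cases h0 : c = 0
    · rw [h0, eq_comm, witness_eq_zero_iff]
      intro m hm
      have hext : Extends (f (2 * i + 3 + 4 * m + 8)) i m :=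
        hm.congr fun k hk => (hstable k _ (by lia)).1.symm
      exact witness_eq_zero_iff.1 ((hcn _ (by lia)).trans h0) m hext
    · obtain ⟨N, hN, hNc, hNF⟩ :
          ∃ N, 2 * i + 3 ≤ N ∧ 4 * c + 8 ≤ N ∧ 4 * witness F i + 8 ≤ N :=
        ⟨2 * i + 3 + (4 * c + 8) + (4 * witness F i + 8), by lia, by lia, by lia⟩
      have hcN := hcn N hN
      have hF : Extends F i c := by
        have := extends_witness_of_ne_zero (hcN ▸ h0)
        rw [hcN] at this
        exact this.congr fun k hk => (hstable k _ (by lia)).1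
      rw [← hcN]
      refine witness_congr (fun _ => by rwa [hcN]) fun m hm => ?_
      exact ⟨witness F i, witness_le hm, (extends_witness hm).congr
        fun k hk => (hstable k _ (by lia)).1.symm⟩
  refine ⟨F, funext fun n => ?_⟩
  rw [← hf (2 * n + 3) n (by lia)]
  refine member_congr (fun i hi => (hstable i _ (by lia)).1.symm) fun i hi => ?_
  rw [(hstable i _ (by lia)).2, hw i]

lemma exists_member_ne_of_agree (f : ℕ → ℕ) (n : ℕ) :
    ∃ g, member g ≠ member f ∧ ∀ i < n, member g i = member f i := by
  obtain ⟨b, hb⟩ := ((Set.finite_Iio n).image (witness f)).bddAbove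
  set M := n + 2 * b + 4 with hM
  obtain ⟨a, ha, hfa⟩ : ∃ a < 2, code f a ≠ f M := by
    by_contra! h
    exact zero_ne_one (code_injective f ((h 0 (by lia)).trans (h 1 (by lia)).symm))
  -- The tail of `g` codes sequences too short to contribute to `Extends g`.
  let g : ℕ → ℕ := fun i => if i < M then f i else code f a
  have hlt : ∀ i < M, g i = f i := fun i hi => if_pos hi
  have hge : ∀ i, M ≤ i → g i = code f a := fun i hi => if_neg hi.not_gt
  have hw : ∀ j < n, witness f j = witness g j := by
    intro j hj
    have hjb : witness f j ≤ b := hb ⟨j, hj, rfl⟩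
    refine witness_congr (fun h => h.congr fun i hi => (hlt i (by lia)).symm) fun m hm => ?_
    refine ⟨m, le_rfl, hm.congr fun i hi => hlt i ?_⟩
    by_contra hMi
    obtain ⟨-, -, u, -, hu⟩ := hm
    rw [hge _ (by lia), code_eq_iff] at hu
    lia
  refine ⟨g, fun h => hfa ?_, fun i hi => member_congr (fun k hk => hlt k (by lia))
    fun k hk => (hw k (by lia)).symm⟩
  rw [← hge M le_rfl, member_injective h]

lemma preperfect_range_member : Preperfect (Set.range member) := by
  rw [preperfect_iff_nhds]
  rintro _ ⟨f, rfl⟩ U hU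
  obtain ⟨_, ⟨x, n, rfl⟩, hx, hsub⟩ :=
    (PiNat.isTopologicalBasis_cylinders fun _ : ℕ => ℕ).mem_nhds_iff.1 hU
  obtain ⟨g, hne, hg⟩ := exists_member_ne_of_agree f n
  rw [PiNat.mem_cylinder_iff] at hx
  exact ⟨member g, ⟨hsub (PiNat.mem_cylinder_iff.2 fun i hi => (hg i hi).trans (hx i hi)),
    g, rfl⟩, hne⟩

end ClosedMED

theorem stmt1 :
    ∃ E : Set (ℕ → ℕ), IsMEDFBaire E ∧ IsClosed E ∧ Perfect E ∧ E.Nonempty :=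
  ⟨Set.range ClosedMED.member, ClosedMED.isMEDFBaire_range_member,
    ClosedMED.isClosed_range_member,
    ⟨ClosedMED.isClosed_range_member, ClosedMED.preperfect_range_member⟩,
    Set.range_nonempty _⟩
end

section
/- Suppose F : ℕ → ℕ∞ satisfies F n ≥ 1 for every n. Then there exists a set ℰ ⊆ 𝒩_F which is a maximal eventually different family in 𝒩_F and is a compact subset of ℕ → ℕ if and only if the set {n : ℕ | F n < ⊤} is infinite. -/
open scoped ENat

lemma EvDiff.symm {g₀ g₁ : ℕ → ℕ} (h : EvDiff g₀ g₁) : EvDiff g₁ g₀ := by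
  simpa only [EvDiff, eq_comm] using h

lemma IsEDF.isMEDF {F : ℕ → ℕ∞} {E : Set (ℕ → ℕ)} (hE : IsEDF F E)
    (h : ∀ g ∈ NF F, ∃ e ∈ E, ¬ EvDiff g e) : IsMEDF F E := by
  refine ⟨hE, fun E' hE' hsub => (Set.Subset.antisymm hsub fun g hg => ?_).symm⟩
  obtain ⟨e, he, hne⟩ := h g (hE'.1 hg)
  by_contra hgE
  exact hne (hE'.2 g hg e (hsub he) fun hge => hgE (hge ▸ he))

lemma IsEDF.insert {F : ℕ → ℕ∞} {E : Set (ℕ → ℕ)} (hE : IsEDF F E) {g : ℕ → ℕ}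
    (hg : g ∈ NF F) (h : ∀ e ∈ E, g ≠ e → EvDiff g e) : IsEDF F (insert g E) := by
  refine ⟨Set.insert_subset hg hE.1, ?_⟩
  rintro x (rfl | hx) y (rfl | hy) hxy
  · exact absurd rfl hxy
  · exact h y hy hxy
  · exact (h x hx hxy.symm).symm
  · exact hE.2 x hx y hy hxy

lemma infinite_of_isCompact_isMEDF {F : ℕ → ℕ∞} (h1 : ∀ n, 1 ≤ F n) {E : Set (ℕ → ℕ)}
    (hE : IsMEDF F E) (hc : IsCompact E) : {n : ℕ | F n < ⊤}.Infinite := by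
  classical
  intro hfin
  have hb : ∀ n, ∃ b, ∀ g ∈ E, g n < b := fun n => by
    obtain ⟨b, hb⟩ := (hc.image (continuous_apply n)).bddAbove
    exact ⟨b + 1, fun g hg => Nat.lt_succ_of_le (hb ⟨g, hg, rfl⟩)⟩
  choose b hb using hb
  let g : ℕ → ℕ := fun n => if F n < ⊤ then 0 else b n
  have hgN : g ∈ NF F := fun n => by
    by_cases hn : F n < ⊤
    · simpa [g, hn] using (zero_lt_one.trans_le (h1 n))
    · have : F n = ⊤ := not_lt_top_iff.1 hn
      simp [g, this]
  have hgE : g ∈ E := by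
    have := hE.2 _ (hE.1.insert hgN fun e he _ => hfin.subset fun n hn => ?_)
      (Set.subset_insert g E)
    · exact this ▸ Set.mem_insert g E
    · by_contra hn'
      have h := hb n e he
      have hn' : ¬ F n < ⊤ := hn'
      have hn : g n = e n := hn
      simp only [g, if_neg hn'] at hn
      omega
  obtain ⟨n, hn⟩ := hfin.infinite_compl.nonempty
  have hn : ¬ F n < ⊤ := hn
  have h := hb n g hgE
  simp only [g, if_neg hn, lt_irrefl] at h

lemma IsEDF.card_le {F : ℕ → ℕ∞} {k : ℕ} (hk : {n | F n ≤ k}.Infinite)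
    {s : Finset (ℕ → ℕ)} (hs : IsEDF F s) : s.card ≤ k := by
  have hfin : (⋃ p ∈ s.offDiag, {n | p.1 n = p.2 n}).Finite :=
    s.offDiag.finite_toSet.biUnion fun p hp => by
      obtain ⟨h₀, h₁, hne⟩ := Finset.mem_offDiag.1 hp
      exact hs.2 _ h₀ _ h₁ hne
  obtain ⟨n, hn, hn'⟩ := (hk.sdiff hfin).nonempty
  rw [← Finset.card_range k]
  refine Finset.card_le_card_of_injOn (fun g => g n) (fun g hg => ?_) fun g hg g' hg' h => ?_
  · have := (hs.1 hg n).trans_le hn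
    simpa using this
  · by_contra hne
    exact hn' (Set.mem_biUnion (x := (g, g')) (Finset.mem_offDiag.2 ⟨hg, hg', hne⟩) h)

lemma exists_finite_isMEDF {F : ℕ → ℕ∞} {k : ℕ} (hk : {n | F n ≤ k}.Infinite) :
    ∃ E : Set (ℕ → ℕ), IsMEDF F E ∧ E.Finite := by
  classical
  let P : ℕ → Prop := fun c => ∃ s : Finset (ℕ → ℕ), IsEDF F s ∧ s.card = c
  have hP : P 0 := ⟨∅, by simp [IsEDF], rfl⟩
  obtain ⟨s, hs, hcard⟩ : P (Nat.findGreatest P k) := Nat.findGreatest_spec (Nat.zero_le k) hP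
  refine ⟨s, ⟨hs, fun E' hE' hsub => (Set.Subset.antisymm hsub fun g hg => ?_).symm⟩,
    s.finite_toSet⟩
  by_contra hgs
  have hins : IsEDF F (insert g s : Finset (ℕ → ℕ)) := by
    rw [Finset.coe_insert]
    exact hs.insert (hE'.1 hg) fun e he hne => hE'.2 g hg e (hsub he) hne
  have h := Nat.le_findGreatest (P := P) (IsEDF.card_le hk hins) ⟨_, hins, rfl⟩
  rw [Finset.card_insert_of_notMem hgs] at h
  omega

/-! ### Recognising the limit of a decreasing sequence of sets at finite stages -/

/-- The last element of `u` before `n`, or `0` if there is none. -/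
def prevMark (u : ℕ → Bool) (n : ℕ) : ℕ := Nat.findGreatest (fun k => u k = true) (n - 1)

lemma prevMark_le (u : ℕ → Bool) (n : ℕ) : prevMark u n ≤ n :=
  (Nat.findGreatest_le _).trans (Nat.sub_le n 1)

lemma le_prevMark {u : ℕ → Bool} {k n : ℕ} (hk : u k = true) (hkn : k < n) :
    k ≤ prevMark u n :=
  Nat.le_findGreatest (by omega) hk

lemma prevMark_spec {u : ℕ → Bool} {k n : ℕ} (hk : u k = true) (hkn : k < n) :
    u (prevMark u n) = true ∧ prevMark u n < n := by
  refine ⟨Nat.findGreatest_spec (P := fun k => u k = true) (m := k) (by omega) hk, ?_⟩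
  have : prevMark u n ≤ n - 1 := Nat.findGreatest_le _
  omega

lemma prevMark_congr {u v : ℕ → Bool} {n : ℕ} (h : ∀ i ≤ n, u i = v i) :
    prevMark u n = prevMark v n := by
  have key : ∀ m ≤ n, Nat.findGreatest (fun k => u k = true) m =
      Nat.findGreatest (fun k => v k = true) m := by
    intro m
    induction m with
    | zero => simp
    | succ m ih =>
      intro hm
      simp only [Nat.findGreatest_succ, h _ hm, ih (by omega)]
  exact key _ (Nat.sub_le n 1)

/-- Let `S n`, `n : ℕ`, be a decreasing sequence of sets. The stage `n` is certified by `u` if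
`u` contains `n` and agrees with `S n` below the first point
that left the sequence between the previous element of `u` and `n`. -/
def Certified (S : ℕ → ℕ → Prop) (u : ℕ → Bool) (n : ℕ) : Prop :=
  u n = true ∧ ∀ i ≤ n, (∀ j ≤ i, S (prevMark u n) j → S n j) → (u i = true ↔ S n i)

lemma Certified.congr {S T : ℕ → ℕ → Prop} {u v : ℕ → Bool} {n : ℕ}
    (hS : ∀ k ≤ n, ∀ i ≤ n, S k i ↔ T k i) (hu : ∀ i ≤ n, u i = v i) (h : Certified S u n) :
    Certified T v n := by
  refine ⟨hu n le_rfl ▸ h.1, fun i hi hj => ?_⟩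
  rw [← hu i hi, ← hS n le_rfl i hi]
  refine h.2 i hi fun j hji => ?_
  rw [hS _ (prevMark_le u n) j (hji.trans hi), hS n le_rfl j (hji.trans hi), prevMark_congr hu]
  exact hj j hji

lemma exists_forall_stable {S : ℕ → ℕ → Prop} (hS : ∀ i, Antitone fun n => S n i) (i : ℕ) :
    ∃ N, ∀ n ≥ N, ∀ j ≤ i, S n j ↔ ∀ m, S m j := by
  have h : ∀ j, ∃ N, ∀ n ≥ N, S n j ↔ ∀ m, S m j := fun j => by
    by_cases hj : ∀ m, S m j
    · exact ⟨0, fun n _ => ⟨fun _ => hj, fun h => h n⟩⟩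
    · obtain ⟨N, hN⟩ := not_forall.1 hj
      exact ⟨N, fun n hn => ⟨fun h => absurd (hS j hn h) hN, fun h => h n⟩⟩
  choose N hN using h
  exact ⟨(Finset.range (i + 1)).sup N, fun n hn j hj => hN j n <|
    (Finset.le_sup (f := N) (Finset.mem_range.2 (Nat.lt_succ_of_le hj))).trans hn⟩

lemma eq_limit_of_infinite_certified {S : ℕ → ℕ → Prop} (hS : ∀ i, Antitone fun n => S n i)
    {u : ℕ → Bool} {B : Set ℕ} (hB : B.Infinite) (hBu : ∀ n ∈ B, Certified S u n) (i : ℕ) :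
    u i = true ↔ ∀ n, S n i := by
  obtain ⟨N, hN⟩ := exists_forall_stable hS i
  obtain ⟨n₀, hn₀, hlt₀⟩ := hB.exists_gt (max N i)
  obtain ⟨n, hn, hlt⟩ := hB.exists_gt n₀
  have hp : n₀ ≤ prevMark u n := le_prevMark (hBu n₀ hn₀).1 hlt
  rw [(hBu n hn).2 i (by omega) fun j hj h => ?_, hN n (by omega) i le_rfl]
  exact (hN _ (by omega) j hj).1 h n

lemma infinite_certified {S : ℕ → ℕ → Prop} (hS : ∀ i, Antitone fun n => S n i)
    {u : ℕ → Bool} (hu : ∀ i, u i = true ↔ ∀ n, S n i) (hinf : {i | u i = true}.Infinite) :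
    {n | Certified S u n}.Infinite := by
  classical
  refine Set.infinite_of_forall_exists_gt fun N => ?_
  obtain ⟨n₀, hn₀, hN⟩ := hinf.exists_gt N
  have hn₀ : u n₀ = true := hn₀
  let H : ℕ → Prop := fun j => ∃ n, n₀ < n ∧ u n = true ∧ S (prevMark u n) j ∧ ¬ S n j
  have hH : ∀ n i, n₀ < n → u n = true → S n i → (¬ ∀ m, S m i) → H i := by
    intro n i hlt hn hSi hi
    obtain ⟨l, hl⟩ := not_forall.1 hi
    have hex : ∃ m, n < m ∧ u m = true ∧ ¬ S m i := by
      obtain ⟨m, hm, hgt⟩ := hinf.exists_gt (max n l)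
      exact ⟨m, by omega, hm, fun h => hl (hS i (by omega : l ≤ m) h)⟩
    obtain ⟨hnm, hm, hSm⟩ := Nat.find_spec hex
    refine ⟨Nat.find hex, hlt.trans hnm, hm, ?_, hSm⟩
    obtain ⟨hp, hpl⟩ := prevMark_spec hn hnm
    by_contra hcon
    rcases (le_prevMark hn hnm).eq_or_lt with heq | hlt'
    · exact hcon (heq ▸ hSi)
    · exact Nat.find_min hex hpl ⟨hlt', hp, hcon⟩
  obtain ⟨n, hlt, hn, hmin⟩ : ∃ n, n₀ < n ∧ u n = true ∧
      ∀ i, (∀ j ≤ i, S (prevMark u n) j → S n j) → ¬ H i := by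
    by_cases hex : ∃ j, H j
    · obtain ⟨n, hlt, hn, hp, hSn⟩ := Nat.find_spec hex
      refine ⟨n, hlt, hn, fun i hi hHi => hSn (hi _ (Nat.find_min' hex hHi) hp)⟩
    · obtain ⟨n, hn, hlt⟩ := hinf.exists_gt n₀
      exact ⟨n, hlt, hn, fun i _ hHi => hex ⟨i, hHi⟩⟩
  refine ⟨n, ⟨hn, fun i _ hi => ?_⟩, hN.trans hlt⟩
  rw [hu i]
  refine ⟨fun h => h n, fun h => ?_⟩
  by_contra hcon
  exact hmin i hi (hH n i hlt hn h hcon)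

/-! ### Almost disjoint sets coding functions -/

/-- The set of all `a (code of f ↾ j)`; for `f ≠ g` these sets are almost disjoint. -/
def branchSet (a f : ℕ → ℕ) : Set ℕ :=
  {n | ∃ j ≤ n, a (Encodable.encode ((List.range j).map f)) = n}

lemma infinite_branchSet {a : ℕ → ℕ} (ha : StrictMono a) (f : ℕ → ℕ) :
    (branchSet a f).Infinite := by
  refine Set.infinite_of_injective_forall_mem
    (f := fun j => a (Encodable.encode ((List.range j).map f))) (fun i j h => ?_) fun j => ?_
  · simpa using congrArg List.length (Encodable.encode_injective (ha.injective h))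
  · refine ⟨j, ?_, rfl⟩
    have := Encodable.length_le_encode ((List.range j).map f)
    simp only [List.length_map, List.length_range] at this
    exact this.trans (ha.id_le _)

lemma finite_branchSet_inter {a : ℕ → ℕ} (ha : StrictMono a) {f g : ℕ → ℕ} (h : f ≠ g) :
    (branchSet a f ∩ branchSet a g).Finite := by
  obtain ⟨k, hk⟩ := Function.ne_iff.1 h
  refine ((Set.finite_le_nat k).image
    fun j => a (Encodable.encode ((List.range j).map f))).subset ?_
  rintro n ⟨⟨i, -, hi⟩, ⟨j, -, hj⟩⟩
  refine ⟨i, ?_, hi⟩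
  have hl := Encodable.encode_injective (ha.injective (hi.trans hj.symm))
  obtain rfl : i = j := by simpa using congrArg List.length hl
  by_contra hki
  exact hk (List.map_inj_left.1 hl k (List.mem_range.2 (not_le.1 hki)))

lemma mem_branchSet_congr {a f g : ℕ → ℕ} {n : ℕ} (h : ∀ i < n, f i = g i) :
    n ∈ branchSet a f ↔ n ∈ branchSet a g := by
  refine exists_congr fun j => and_congr_right fun hj => ?_
  rw [List.map_inj_left.2 fun i hi => h i ((List.mem_range.1 hi).trans_le hj)]

/-! ### Separating codes -/

/-- A coherent sequence of finer and finer codes for the points of `K`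
whose `n`th code lies below `F n`. -/
structure IsCoding (F : ℕ → ℕ∞) (K : Set ((ℕ → ℕ) × (ℕ → Bool)))
    (c : ℕ → (ℕ → ℕ) × (ℕ → Bool) → ℕ) : Prop where
  lt : ∀ n, ∀ x ∈ K, (c n x : ℕ∞) < F n
  congr : ∀ n x y, (∀ i < n, x.1 i = y.1 i ∧ x.2 i = y.2 i) → c n x = c n y
  mono : ∀ n m x y, n ≤ m → c m x = c m y → c n x = c n y
  sep : ∀ x y, x ≠ y → ∃ n, c n x ≠ c n y

lemma continuous_of_congr {q : (ℕ → ℕ) × (ℕ → Bool) → ℕ} {n : ℕ}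
    (h : ∀ x y, (∀ i < n, x.1 i = y.1 i ∧ x.2 i = y.2 i) → q x = q y) : Continuous q := by
  refine continuous_iff_continuousAt.2 fun x => tendsto_nhds_of_eventually_eq ?_
  have h₁ : ∀ i, ∀ᶠ y in nhds x, x.1 i = y.1 i ∧ x.2 i = y.2 i := fun i => by
    have c₁ : Continuous fun y : (ℕ → ℕ) × (ℕ → Bool) => y.1 i := by fun_prop
    have c₂ : Continuous fun y : (ℕ → ℕ) × (ℕ → Bool) => y.2 i := by fun_prop
    filter_upwards [c₁.continuousAt.eventually (Filter.eventually_of_mem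
        (mem_nhds_discrete.2 rfl : {x.1 i} ∈ nhds (x.1 i)) fun _ h => h),
      c₂.continuousAt.eventually (Filter.eventually_of_mem
        (mem_nhds_discrete.2 rfl : {x.2 i} ∈ nhds (x.2 i)) fun _ h => h)] with y hy₁ hy₂
    exact ⟨hy₁.symm, hy₂.symm⟩
  filter_upwards [(Set.finite_lt_nat n).eventually_all.2 fun i _ => h₁ i] with y hy
  exact (h x y hy).symm

lemma exists_isCoding {F : ℕ → ℕ∞} (h1 : ∀ n, 1 ≤ F n) (hF : ∀ k : ℕ, {n | F n ≤ k}.Finite)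
    {K : Set ((ℕ → ℕ) × (ℕ → Bool))} (hK : IsCompact K) : ∃ c, IsCoding F K c := by
  classical
  let q : ℕ → (ℕ → ℕ) × (ℕ → Bool) → ℕ := fun k x =>
    Encodable.encode ((List.range k).map fun i => (x.1 i, x.2 i))
  have hq : ∀ k x y, q k x = q k y ↔ ∀ i < k, x.1 i = y.1 i ∧ x.2 i = y.2 i := by
    intro k x y
    simp only [q, Encodable.encode_inj, List.map_inj_left, List.mem_range, Prod.mk.injEq]
  let P : ℕ → ℕ → Prop := fun n k => ∀ n' ≥ n, ∀ x ∈ K, (q k x : ℕ∞) < F n'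
  have hP0 : ∀ n, P n 0 := fun n n' _ x _ => by
    simpa [q] using zero_lt_one.trans_le (h1 n')
  let m : ℕ → ℕ := fun n => Nat.findGreatest (P n) n
  have hmP : ∀ n, P n (m n) := fun n => Nat.findGreatest_spec (Nat.zero_le n) (hP0 n)
  have hm_le : ∀ n, m n ≤ n := fun n => Nat.findGreatest_le n
  have hm_mono : Monotone m := fun n n' h =>
    Nat.le_findGreatest ((hm_le n).trans h) fun l hl => hmP n l (h.trans hl)
  have hm_top : ∀ k, ∃ n, k ≤ m n := by
    intro k
    have hqc : Continuous (q k) := continuous_of_congr fun x y => (hq k x y).2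
    obtain ⟨N, hN⟩ := (hK.image hqc).bddAbove
    obtain ⟨n₀, hn₀⟩ := (hF N).bddAbove
    refine ⟨max k (n₀ + 1), Nat.le_findGreatest (le_max_left _ _) fun n' hn' x hx => ?_⟩
    have h₁ : q k x ≤ N := hN ⟨x, hx, rfl⟩
    have h₂ : ¬ F n' ≤ N := fun h => by
      have : n' ≤ n₀ := hn₀ h
      omega
    exact (Nat.cast_le.2 h₁).trans_lt (not_le.1 h₂)
  refine ⟨fun n => q (m n), fun n x hx => hmP n n le_rfl x hx, fun n x y h => ?_,
    fun n n' x y h hxy => ?_, fun x y hxy => ?_⟩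
  · exact (hq _ _ _).2 fun i hi => h i (hi.trans_le (hm_le n))
  · exact (hq _ _ _).2 fun i hi => (hq _ _ _).1 hxy i (hi.trans_le (hm_mono h))
  · by_contra! hcon
    refine hxy (Prod.ext (funext fun i => ?_) (funext fun i => ?_))
    all_goals
      obtain ⟨n, hn⟩ := hm_top (i + 1)
      have := (hq _ _ _).1 (hcon n) i hn
      simp [this]

/-! ### The compact family -/

section Graft

variable (K : Set ((ℕ → ℕ) × (ℕ → Bool))) (c : ℕ → (ℕ → ℕ) × (ℕ → Bool) → ℕ) (a : ℕ → ℕ)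

/-- `f i` and `f m` are codes of a common point of `K`. -/
def Coheres (f : ℕ → ℕ) (i m : ℕ) : Prop := i < m ∧ ∃ y ∈ K, c i y = f i ∧ c m y = f m

/-- No later point of the branch set up to stage `n` coheres with `i`. -/
def Terminal (f : ℕ → ℕ) (n i : ℕ) : Prop :=
  i ∈ branchSet a f ∧ ∀ m ≤ n, m ∈ branchSet a f → ¬ Coheres K c f i m

/-- The points at which the code of `x` is replaced by the values of `x.1`. -/
def graftSet (x : (ℕ → ℕ) × (ℕ → Bool)) : Set ℕ :=
  {n | n ∈ branchSet a x.1 ∧ Certified (Terminal K c a x.1) x.2 n}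

open Classical in
/-- The sequence of codes of `x`, with values of `x.1` grafted in on `graftSet K c a x`. -/
noncomputable def graft (x : (ℕ → ℕ) × (ℕ → Bool)) (n : ℕ) : ℕ :=
  if n ∈ graftSet K c a x then x.1 n else c n x

variable {K c a}

lemma antitone_terminal (f : ℕ → ℕ) (i : ℕ) : Antitone fun n => Terminal K c a f n i :=
  fun _ _ h hi => ⟨hi.1, fun m hm => hi.2 m (hm.trans h)⟩

lemma Terminal.congr {f g : ℕ → ℕ} {n k i : ℕ} (h : ∀ l ≤ n, f l = g l) (hk : k ≤ n)
    (hi : i ≤ n) (ht : Terminal K c a f k i) : Terminal K c a g k i := by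
  have hb : ∀ l ≤ n, l ∈ branchSet a f ↔ l ∈ branchSet a g := fun l hl =>
    mem_branchSet_congr fun j hj => h j (hj.le.trans hl)
  refine ⟨(hb i hi).1 ht.1, fun m hm hmb => ?_⟩
  have := ht.2 m hm ((hb m (hm.trans hk)).2 hmb)
  rwa [Coheres, h i hi, h m (hm.trans hk)] at this

lemma mem_graftSet_of_congr {x y : (ℕ → ℕ) × (ℕ → Bool)} {n : ℕ}
    (h : ∀ i ≤ n, x.1 i = y.1 i ∧ x.2 i = y.2 i) (hx : n ∈ graftSet K c a x) :
    n ∈ graftSet K c a y :=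
  ⟨(mem_branchSet_congr fun i hi => (h i hi.le).1).1 hx.1,
    hx.2.congr (fun _ hk _ hi =>
      ⟨fun ht => ht.congr (fun l hl => (h l hl).1) hk hi,
        fun ht => ht.congr (fun l hl => (h l hl).1.symm) hk hi⟩) fun i hi => (h i hi).2⟩

lemma continuous_graft {F : ℕ → ℕ∞} (hc : IsCoding F K c) : Continuous (graft K c a) := by
  refine continuous_pi fun n => continuous_of_congr (n := n + 1) fun x y h => ?_
  have h' : ∀ i ≤ n, x.1 i = y.1 i ∧ x.2 i = y.2 i := fun i hi => h i (Nat.lt_succ_of_le hi)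
  have hiff : n ∈ graftSet K c a x ↔ n ∈ graftSet K c a y :=
    ⟨mem_graftSet_of_congr h',
      mem_graftSet_of_congr fun i hi => ⟨(h' i hi).1.symm, (h' i hi).2.symm⟩⟩
  by_cases hn : n ∈ graftSet K c a x
  · rw [graft, graft, if_pos hn, if_pos (hiff.1 hn), (h' n le_rfl).1]
  · rw [graft, graft, if_neg hn, if_neg (hiff.not.1 hn)]
    exact hc.congr n x y fun i hi => h' i hi.le

lemma eq_terminal_of_infinite_graftSet {x : (ℕ → ℕ) × (ℕ → Bool)}
    (h : (graftSet K c a x).Infinite) (i : ℕ) :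
    x.2 i = true ↔ ∀ n, Terminal K c a x.1 n i :=
  eq_limit_of_infinite_certified (antitone_terminal x.1) h (fun _ hn => hn.2) i

lemma IsCoding.finite_eq {F : ℕ → ℕ∞} (hc : IsCoding F K c) {x y : (ℕ → ℕ) × (ℕ → Bool)}
    (h : x ≠ y) : {n | c n x = c n y}.Finite := by
  obtain ⟨k, hk⟩ := hc.sep x y h
  refine (Set.finite_lt_nat k).subset fun n hn => ?_
  by_contra hkn
  exact hk (hc.mono k n x y (not_lt.1 hkn) hn)

lemma finite_graftSet_code {x y : (ℕ → ℕ) × (ℕ → Bool)} (hy : y ∈ K) :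
    {n ∈ graftSet K c a x | c n y = x.1 n}.Finite := by
  by_contra hinf
  have hinf : {n ∈ graftSet K c a x | c n y = x.1 n}.Infinite := hinf
  have hu := eq_terminal_of_infinite_graftSet (hinf.mono fun n hn => hn.1)
  obtain ⟨n, hn⟩ := hinf.nonempty
  obtain ⟨m, hm, hlt⟩ := hinf.exists_gt n
  exact ((hu n).1 hn.1.2.1 m).2 m le_rfl hm.1.1 ⟨hlt, y, hy, hn.2, hm.2⟩

lemma finite_graftSet_inter (ha : StrictMono a) {x y : (ℕ → ℕ) × (ℕ → Bool)} (h : x ≠ y) :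
    (graftSet K c a x ∩ graftSet K c a y).Finite := by
  by_cases h₁ : x.1 = y.1
  · by_contra hinf
    have hinf : (graftSet K c a x ∩ graftSet K c a y).Infinite := hinf
    refine h (Prod.ext h₁ (funext fun i => Bool.eq_iff_iff.2 ?_))
    rw [eq_terminal_of_infinite_graftSet (hinf.mono Set.inter_subset_left) i,
      eq_terminal_of_infinite_graftSet (hinf.mono Set.inter_subset_right) i, h₁]
  · exact (finite_branchSet_inter ha h₁).subset fun n hn => ⟨hn.1.1, hn.2.1⟩

lemma evDiff_graft {F : ℕ → ℕ∞} (hc : IsCoding F K c) (ha : StrictMono a)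
    {x y : (ℕ → ℕ) × (ℕ → Bool)} (hx : x ∈ K) (hy : y ∈ K) (h : x ≠ y) :
    EvDiff (graft K c a x) (graft K c a y) := by
  refine (((hc.finite_eq h).union (finite_graftSet_inter (K := K) (c := c) ha h)).union
    ((finite_graftSet_code (c := c) (a := a) (x := x) hy).union
      (finite_graftSet_code (c := c) (a := a) (x := y) hx))).subset fun n hn => ?_
  have hn : graft K c a x n = graft K c a y n := hn
  by_cases hnx : n ∈ graftSet K c a x <;> by_cases hny : n ∈ graftSet K c a y
  · exact Or.inl (Or.inr ⟨hnx, hny⟩)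
  · rw [graft, graft, if_pos hnx, if_neg hny] at hn
    exact Or.inr (Or.inl ⟨hnx, hn.symm⟩)
  · rw [graft, graft, if_neg hnx, if_pos hny] at hn
    exact Or.inr (Or.inr ⟨hny, hn⟩)
  · rw [graft, graft, if_neg hnx, if_neg hny] at hn
    exact Or.inl (Or.inl hn)

lemma exists_infinite_code_of_finite_terminal {F : ℕ → ℕ∞} (hc : IsCoding F K c)
    (hK : IsCompact K) (ha : StrictMono a) {f : ℕ → ℕ}
    (hfin : {i | ∀ n, Terminal K c a f n i}.Finite) :
    ∃ y ∈ K, {n ∈ branchSet a f | c n y = f n}.Infinite := by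
  obtain ⟨N, hN⟩ := hfin.bddAbove
  have hstep : ∀ i, i ∈ branchSet a f → N < i → ∃ m ∈ branchSet a f, Coheres K c f i m := by
    intro i hi hlt
    by_contra! hcon
    exact absurd (hN fun n => ⟨hi, fun m _ hm => hcon m hm⟩ : i ≤ N) (not_le.2 hlt)
  obtain ⟨n₀, hn₀, hlt₀⟩ := (infinite_branchSet ha f).exists_gt N
  let T := {i // i ∈ branchSet a f ∧ N < i}
  have hstep' : ∀ i : T, ∃ m : T, Coheres K c f i m := fun i => by
    obtain ⟨m, hm, hco⟩ := hstep i i.2.1 i.2.2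
    exact ⟨⟨m, hm, i.2.2.trans hco.1⟩, hco⟩
  choose next hnext using hstep'
  let s : ℕ → T := fun k => next^[k] ⟨n₀, hn₀, hlt₀⟩
  have hs : ∀ k, Coheres K c f (s k) (s (k + 1)) := fun k => by
    simp only [s, Function.iterate_succ_apply']
    exact hnext _
  have hmono : StrictMono fun k => (s k : ℕ) := strictMono_nat_of_lt_succ fun k => (hs k).1
  let C : ℕ → Set ((ℕ → ℕ) × (ℕ → Bool)) := fun k => K ∩ {y | c (s k) y = f (s k)}
  have hcont : ∀ n, Continuous (c n) := fun n => continuous_of_congr (hc.congr n)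
  have hclosed : ∀ k, IsClosed {y | c (s k) y = f (s k)} := fun k =>
    isClosed_eq (hcont _) continuous_const
  obtain ⟨y, hy⟩ := IsCompact.nonempty_iInter_of_sequence_nonempty_isCompact_isClosed C
    (fun k y hy => by
      obtain ⟨hlt, z, -, hz, hz'⟩ := hs k
      exact ⟨hy.1, (hc.mono _ _ y z hlt.le (hy.2.trans hz'.symm)).trans hz⟩)
    (fun k => by
      obtain ⟨-, z, hzK, hz, -⟩ := hs k
      exact ⟨z, hzK, hz⟩)
    (hK.inter_right (hclosed 0)) (fun k => hK.isClosed.inter (hclosed k))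
  have hy := Set.mem_iInter.1 hy
  exact ⟨y, (hy 0).1, Set.infinite_of_injective_forall_mem hmono.injective
    fun k => ⟨(s k).2.1, (hy k).2⟩⟩

lemma exists_infinite_graft_eq {F : ℕ → ℕ∞} (hc : IsCoding F K c)
    (hK : IsCompact K) (ha : StrictMono a) {f : ℕ → ℕ} (hf : ∀ u, (f, u) ∈ K) :
    ∃ y ∈ K, {n ∈ branchSet a f | f n = graft K c a y n}.Infinite := by
  classical
  by_cases hfin : {i | ∀ n, Terminal K c a f n i}.Finite
  · obtain ⟨y, hy, hinf⟩ := exists_infinite_code_of_finite_terminal hc hK ha hfin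
    refine ⟨y, hy, ?_⟩
    by_cases hfy : f = y.1
    · refine hinf.mono fun n hn => ⟨hn.1, ?_⟩
      rw [graft]
      split_ifs
      · rw [hfy]
      · exact hn.2.symm
    · refine (hinf.sdiff (finite_branchSet_inter ha hfy)).mono fun n hn => ⟨hn.1.1, ?_⟩
      rw [graft, if_neg fun h => hn.2 ⟨hn.1.1, h.1⟩]
      exact hn.1.2.symm
  · let u : ℕ → Bool := fun i => decide (∀ n, Terminal K c a f n i)
    have hu : ∀ i, u i = true ↔ ∀ n, Terminal K c a f n i := fun i => decide_eq_true_iff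
    have hinf : {i | u i = true}.Infinite := by
      simpa only [hu, Set.Infinite] using hfin
    refine ⟨(f, u), hf u, (infinite_certified (antitone_terminal f) hu hinf).mono fun n hn => ?_⟩
    have hnb : n ∈ branchSet a f := ((hu n).1 hn.1 0).1
    refine ⟨hnb, ?_⟩
    rw [graft, if_pos ⟨hnb, hn⟩]

end Graft

lemma branchSet_subset_range (a f : ℕ → ℕ) : branchSet a f ⊆ Set.range a := by
  rintro _ ⟨j, -, rfl⟩
  exact Set.mem_range_self _

lemma exists_isCompact_isMEDF {F : ℕ → ℕ∞} (h1 : ∀ n, 1 ≤ F n)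
    (hF : ∀ k : ℕ, {n | F n ≤ k}.Finite) (hA : {n | F n < ⊤}.Infinite) :
    ∃ E : Set (ℕ → ℕ), IsMEDF F E ∧ IsCompact E := by
  classical
  let T : ℕ → Set ℕ := fun n => {k | (k : ℕ∞) < F n ∧ (F n = ⊤ → k = 0)}
  have hT : ∀ n, (T n).Finite := fun n => by
    by_cases hn : F n = ⊤
    · exact (Set.finite_singleton 0).subset fun k hk => hk.2 hn
    · obtain ⟨b, hb⟩ := ENat.ne_top_iff_exists.1 hn
      refine (Set.finite_lt_nat b).subset fun k hk => ?_
      have := hk.1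
      rw [← hb] at this
      exact Nat.cast_lt.1 this
  let K : Set ((ℕ → ℕ) × (ℕ → Bool)) := Set.pi Set.univ T ×ˢ Set.univ
  have hK : IsCompact K := (isCompact_univ_pi fun n => (hT n).isCompact).prod isCompact_univ
  obtain ⟨c, hc⟩ := exists_isCoding h1 hF hK
  let a : ℕ → ℕ := Nat.nth fun n => F n < ⊤
  have ha : StrictMono a := Nat.nth_strictMono hA
  have haF : ∀ n ∈ Set.range a, F n < ⊤ := by
    rintro _ ⟨k, rfl⟩
    exact Nat.nth_mem_of_infinite hA k
  refine ⟨graft K c a '' K, IsEDF.isMEDF ⟨?_, ?_⟩ fun g hg => ?_,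
    hK.image (continuous_graft hc)⟩
  · rintro _ ⟨x, hx, rfl⟩ n
    rw [graft]
    split_ifs
    · exact (hx.1 n trivial).1
    · exact hc.lt n x hx
  · rintro _ ⟨x, hx, rfl⟩ _ ⟨y, hy, rfl⟩ hxy
    exact evDiff_graft hc ha hx hy fun h => hxy (h ▸ rfl)
  · let f : ℕ → ℕ := fun n => if F n < ⊤ then g n else 0
    have hf : ∀ u, (f, u) ∈ K := fun u => ⟨fun n _ => by
      by_cases hn : F n < ⊤
      · exact ⟨by simpa [f, hn] using hg n, fun h => absurd h hn.ne⟩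
      · exact ⟨by simpa [f, hn] using zero_lt_one.trans_le (h1 n), fun _ => if_neg hn⟩, trivial⟩
    obtain ⟨y, hy, hinf⟩ := exists_infinite_graft_eq hc hK ha hf
    refine ⟨_, ⟨y, hy, rfl⟩, fun hfin => hinf (hfin.subset fun n hn => ?_)⟩
    have hgf : f n = g n := if_pos (haF n (branchSet_subset_range a f hn.1))
    exact hgf.symm.trans hn.2

theorem stmt4 (F : ℕ → ℕ∞) (h1 : ∀ n, 1 ≤ F n) :
    (∃ E : Set (ℕ → ℕ), IsMEDF F E ∧ IsCompact E) ↔ {n : ℕ | F n < ⊤}.Infinite := by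
  refine ⟨fun ⟨E, hE, hc⟩ => infinite_of_isCompact_isMEDF h1 hE hc, fun hA => ?_⟩
  by_cases hF : ∀ k : ℕ, {n | F n ≤ k}.Finite
  · exact exists_isCompact_isMEDF h1 hF hA
  · obtain ⟨k, hk⟩ := not_forall.1 hF
    obtain ⟨E, hE, hfin⟩ := exists_finite_isMEDF hk
    exact ⟨E, hE, hfin.isCompact⟩
end

section
/- Suppose F : ℕ → ℕ∞ satisfies F n ≥ 1 for every n and the set {n : ℕ | F n < ⊤} is finite. Then no compact subset of ℕ → ℕ contained in 𝒩_F is a maximal eventually different family in 𝒩_F. -/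
open scoped ENat

theorem stmt5 (F : ℕ → ℕ∞) (h1 : ∀ n, 1 ≤ F n) (hfin : {n : ℕ | F n < ⊤}.Finite) :
    ∀ E : Set (ℕ → ℕ), IsCompact E → E ⊆ NF F → ¬ IsMEDF F E := by
  rintro E hE hsub ⟨⟨-, hED⟩, hmax⟩
  choose B hB using fun n => (hE.image (continuous_apply n)).bddAbove
  have hle : ∀ f ∈ E, ∀ n, f n ≤ B n := fun f hf n => hB n ⟨f, hf, rfl⟩
  classical
  let g : ℕ → ℕ := fun n => if F n < ⊤ then 0 else B n + 1
  have hgF : g ∈ NF F := by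
    intro n
    by_cases hn : F n < ⊤
    · simpa [g, hn] using zero_lt_one.trans_le (h1 n)
    · simpa only [not_lt_top_iff.mp hn] using ENat.natCast_lt_top (g n)
  have hne : ∀ f ∈ E, ∀ n, ¬ F n < ⊤ → f n < g n := fun f hf n hn => by
    simpa [g, hn, Nat.lt_succ_iff] using hle f hf n
  have hgE : g ∉ E := fun hg => by
    obtain ⟨n, hn⟩ := hfin.exists_notMem
    exact (hne g hg n hn).false
  have hdiff : ∀ f ∈ E, {n | f n = g n}.Finite := fun f hf =>
    hfin.subset fun n hn => by_contra fun h => (hne f hf n h).ne hn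
  refine hgE (hmax (insert g E) ⟨Set.insert_subset hgF hsub, ?_⟩ (Set.subset_insert g E) ▸
    Set.mem_insert g E)
  rintro f₀ (rfl | h₀) f₁ (rfl | h₁) hf
  · exact absurd rfl hf
  · simpa only [EvDiff, eq_comm] using hdiff f₁ h₁
  · exact hdiff f₀ h₀
  · exact hED f₀ h₀ f₁ h₁ hf
end

section
/- Suppose F : ℕ → ℕ∞ and m : ℕ are such that the set {n : ℕ | F n ≤ m} is infinite. Then every eventually different family in 𝒩_F has at most m elements; in particular, every eventually different family in 𝒩_F is finite. -/
open scoped ENat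

/-- A finite set of functions that is an eventually different family in `𝒩_F` has at most `m`
elements if `F n ≤ m` for infinitely many `n`: outside a finite set of indices, evaluation is
injective on the family. -/
theorem IsEDF.card_le_s7 {F : ℕ → ℕ∞} {m : ℕ} (hinf : {n : ℕ | F n ≤ (m : ℕ∞)}.Infinite)
    {T : Finset (ℕ → ℕ)} (hT : IsEDF F (T : Set (ℕ → ℕ))) : T.card ≤ m := by
  classical
  have hfin : (⋃ p ∈ T.offDiag, {n | p.1 n = p.2 n}).Finite := by
    refine T.offDiag.finite_toSet.biUnion fun p hp => ?_
    obtain ⟨h₁, h₂, hne⟩ := Finset.mem_offDiag.1 (Finset.mem_coe.1 hp)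
    exact hT.2 _ h₁ _ h₂ hne
  obtain ⟨n, hn, hn'⟩ := hinf.exists_notMem_finite hfin
  have hmaps : Set.MapsTo (fun g : ℕ → ℕ => g n) T (Finset.range m) := fun g hg =>
    Finset.mem_coe.2 (Finset.mem_range.2 (by exact_mod_cast (hT.1 hg n).trans_le hn))
  have hinj : Set.InjOn (fun g : ℕ → ℕ => g n) T := by
    intro g hg g' hg' heq
    by_contra hne
    exact hn' (Set.mem_biUnion (x := (g, g')) (Finset.mem_offDiag.2 ⟨hg, hg', hne⟩) heq)
  simpa using Finset.card_le_card_of_injOn _ hmaps hinj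

theorem IsEDF.mono {F : ℕ → ℕ∞} {E E' : Set (ℕ → ℕ)} (hE : IsEDF F E) (h : E' ⊆ E) :
    IsEDF F E' :=
  ⟨h.trans hE.1, fun g₀ h₀ g₁ h₁ => hE.2 g₀ (h h₀) g₁ (h h₁)⟩

theorem stmt7 (F : ℕ → ℕ∞) (m : ℕ) (hinf : {n : ℕ | F n ≤ (m : ℕ∞)}.Infinite) :
    ∀ E : Set (ℕ → ℕ), IsEDF F E → E.Finite ∧ E.ncard ≤ m := by
  intro E hE
  have hfin : E.Finite := by
    by_contra hE'
    obtain ⟨T, hTE, hcard⟩ := Set.Infinite.exists_subset_card_eq hE' (m + 1)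
    have := (hE.mono hTE).card_le_s7 hinf
    omega
  refine ⟨hfin, ?_⟩
  rw [Set.ncard_eq_toFinset_card E hfin]
  exact (hE.mono (by simp)).card_le_s7 hinf
end

section
/- Suppose F : ℕ → ℕ∞ and m : ℕ with m ≥ 1 are such that the set {n : ℕ | F n = m} is infinite and m ≤ F n for every n. Then the set of constant functions {c_k | k < m}, where c_k : ℕ → ℕ has constant value k, is a maximal eventually different family in 𝒩_F. -/
open scoped ENat

theorem stmt8 (F : ℕ → ℕ∞) (m : ℕ) (hm : 1 ≤ m)
    (hinf : {n : ℕ | F n = (m : ℕ∞)}.Infinite) (hle : ∀ n, (m : ℕ∞) ≤ F n) :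
    IsMEDF F {f : ℕ → ℕ | ∃ k < m, f = Function.const ℕ k} := by
  refine ⟨⟨?_, ?_⟩, fun E' ⟨hsub, hdiff⟩ hE => (Set.Subset.antisymm hE ?_).symm⟩
  · rintro _ ⟨k, hk, rfl⟩ n
    exact (Nat.cast_lt.mpr hk).trans_le (hle n)
  · rintro _ ⟨k, _, rfl⟩ _ ⟨l, _, rfl⟩ hne
    have hkl : k ≠ l := fun h => hne (h ▸ rfl)
    simp [EvDiff, hkl]
  · intro g hg
    by_contra hgc
    refine hinf (((Set.finite_Iio m).biUnion (t := fun k => {n | g n = Function.const ℕ k n})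
      fun k hk => hdiff g hg _ (hE ⟨k, hk, rfl⟩) fun h => hgc ⟨k, hk, h⟩).subset ?_)
    intro n hn
    have hlt : g n < m := Nat.cast_lt.mp ((hsub hg n).trans_eq hn)
    exact Set.mem_biUnion (Set.mem_Iio.mpr hlt) rfl
end

section
/- Suppose F : ℕ → ℕ∞ satisfies F n ≥ 1 for every n and F tends to ⊤ (i.e., for every m : ℕ, F n > m for all sufficiently large n). Then for every countable set ℰ ⊆ 𝒩_F there exists g ∈ 𝒩_F with g ∉ ℰ such that g is eventually different from every member of ℰ. In particular, no countable eventually different family in 𝒩_F is maximal. -/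
open scoped ENat

theorem not_evDiff_self (g : ℕ → ℕ) : ¬ EvDiff g g := by
  simpa [EvDiff] using Set.infinite_univ (α := ℕ)

theorem exists_le_forall_lt_ne (a : ℕ → ℕ) (k : ℕ) : ∃ v ≤ k, ∀ i < k, v ≠ a i := by
  have hcard : ((Finset.range k).image a).card < (Finset.range (k + 1)).card :=
    Finset.card_image_le.trans_lt (by simp)
  obtain ⟨v, hv, hva⟩ := Finset.exists_mem_notMem_of_card_lt_card hcard
  refine ⟨v, Nat.lt_succ_iff.mp (Finset.mem_range.mp hv), fun i hi h => hva ?_⟩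
  exact Finset.mem_image.mpr ⟨i, Finset.mem_range.mpr hi, h.symm⟩

theorem stmt9 (F : ℕ → ℕ∞) (h1 : ∀ n, 1 ≤ F n)
    (htop : ∀ m : ℕ, ∀ᶠ n in Filter.atTop, (m : ℕ∞) < F n) :
    ∀ E : Set (ℕ → ℕ), E ⊆ NF F → E.Countable →
      ∃ g ∈ NF F, g ∉ E ∧ ∀ f ∈ E, EvDiff g f := by
  intro E _ hE
  obtain ⟨f, hf⟩ := Set.countable_iff_exists_subset_range.mp hE
  let k : ℕ → ℕ := fun n => Nat.findGreatest (fun m => (m : ℕ∞) < F n) n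
  have hk (n : ℕ) : (k n : ℕ∞) < F n :=
    Nat.findGreatest_spec (P := fun m : ℕ => (m : ℕ∞) < F n) n.zero_le
      (by simpa using zero_lt_one.trans_le (h1 n))
  choose g hgk hg using fun n => exists_le_forall_lt_ne (fun i => f i n) (k n)
  have hgE : ∀ e ∈ E, EvDiff g e := by
    intro e he
    obtain ⟨i, rfl⟩ := hf he
    have hev : ∀ᶠ n in Filter.atTop, g n ≠ f i n := by
      filter_upwards [htop (i + 1), Filter.eventually_ge_atTop (i + 1)] with n hn hin
      exact hg n i (Nat.le_findGreatest hin hn)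
    rw [← Nat.cofinite_eq_atTop, Filter.eventually_cofinite] at hev
    simpa [EvDiff] using hev
  exact ⟨g, fun n => (Nat.cast_le.mpr (hgk n)).trans_lt (hk n),
    fun h => not_evDiff_self g (hgE g h), hgE⟩
end

section
/- Suppose F : ℕ → ℕ∞ satisfies F n ≥ 1 for every n, the set {n | F n < ⊤} is infinite, and F tends to ⊤ (i.e., for every m : ℕ, F n > m for all sufficiently large n). Then there exists a set ℰ ⊆ 𝒩_F which is a maximal eventually different family in 𝒩_F, is a compact subset of ℕ → ℕ, and is a perfect set (nonempty, closed, and without isolated points). -/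
open scoped ENat

/-! The family is the injective continuous image of Cantor space under a map `x ↦ member x`.
A point `x` is read as a pair `(a, y)`, its even and odd parts, and `a` names a function
`g = decoded F a`. By default `member x n` is a code of a prefix of `x`. At certain `n` in a set
attached to `a` (these sets are almost disjoint) it is `g n` instead: those where `g n` is not the
code of a prefix of `y`, and the point coded by `g n` is closer to `y` than at all earlier
such places.
-/

open Filter Topology

namespace EventuallyDifferent

/-- The even-indexed part of a point of Cantor space. -/
def evens (x : ℕ → Bool) : ℕ → Bool := fun i => x (2 * i)

/-- The odd-indexed part of a point of Cantor space. -/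
def odds (x : ℕ → Bool) : ℕ → Bool := fun i => x (2 * i + 1)

/-- The point with given even and odd parts. -/
def interleave (a y : ℕ → Bool) : ℕ → Bool := fun i => if i % 2 = 0 then a (i / 2) else y (i / 2)

@[simp] theorem evens_interleave (a y : ℕ → Bool) : evens (interleave a y) = a := by
  funext i
  simp [evens, interleave]

@[simp] theorem odds_interleave (a y : ℕ → Bool) : odds (interleave a y) = y := by
  funext i
  have h : (2 * i + 1) / 2 = i := by omega
  simp [odds, interleave, h]

theorem eq_of_evens_eq_of_odds_eq {x x' : ℕ → Bool} (he : evens x = evens x')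
    (ho : odds x = odds x') : x = x' := by
  funext i
  obtain ⟨j, rfl | rfl⟩ : ∃ j, i = 2 * j ∨ i = 2 * j + 1 := ⟨i / 2, by omega⟩
  · exact congrFun he j
  · exact congrFun ho j

theorem eventually_apply_eq (x : ℕ → Bool) (i : ℕ) : ∀ᶠ x' in 𝓝 x, x' i = x i :=
  (continuous_apply i).continuousAt.eventually_mem (by simp : {x i} ∈ 𝓝 (x i))

/-- The length, at most `n`, of the longest common prefix. -/
def agreement (u y : ℕ → Bool) (n : ℕ) : ℕ := by
  classical exact Nat.findGreatest (fun j => ∀ i < j, u i = y i) n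

theorem agreement_le_of_ne {u y : ℕ → Bool} {i : ℕ} (h : u i ≠ y i) (n : ℕ) :
    agreement u y n ≤ i := by
  classical
  by_contra! hlt
  have := Nat.findGreatest_spec (P := fun j => ∀ i < j, u i = y i) (n := n) (Nat.zero_le n)
    (by simp)
  exact h (this i hlt)

theorem le_agreement {u y : ℕ → Bool} {l n : ℕ} (hl : l ≤ n) (h : ∀ i < l, u i = y i) :
    l ≤ agreement u y n := by
  classical exact Nat.le_findGreatest hl h

theorem agreement_congr {u y y' : ℕ → Bool} {n : ℕ} (h : ∀ i < n, y' i = y i) :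
    agreement u y' n = agreement u y n := by
  apply le_antisymm <;> refine le_agreement (Nat.findGreatest_le n) fun i hi => ?_ <;>
    by_contra hne
  · rw [← h i (hi.trans_le (Nat.findGreatest_le n))] at hne
    exact absurd (agreement_le_of_ne hne n) (not_le.2 hi)
  · rw [h i (hi.trans_le (Nat.findGreatest_le n))] at hne
    exact absurd (agreement_le_of_ne hne n) (not_le.2 hi)

/-- The function named by `a`. -/
noncomputable def decoded (F : ℕ → ℕ∞) (a : ℕ → Bool) (n : ℕ) : ℕ := by
  classical exact
    if h : ∃ v : ℕ, (v : ℕ∞) < F n ∧ a (Nat.pair n v) = true then Nat.find h else 0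

theorem decoded_lt {F : ℕ → ℕ∞} (h1 : ∀ n, 1 ≤ F n) (a : ℕ → Bool) (n : ℕ) :
    (decoded F a n : ℕ∞) < F n := by
  classical
  unfold decoded
  split_ifs with h
  · exact (Nat.find_spec h).1
  · simpa using zero_lt_one.trans_le (h1 n)

theorem exists_decoded_eq {F : ℕ → ℕ∞} {g : ℕ → ℕ} (hg : g ∈ NF F) : ∃ a, decoded F a = g := by
  classical
  let a : ℕ → Bool := fun i => decide (g i.unpair.1 = i.unpair.2)
  have ha (n v : ℕ) : a (Nat.pair n v) = true ↔ g n = v := by simp [a]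
  refine ⟨a, funext fun n => ?_⟩
  have h : ∃ v : ℕ, (v : ℕ∞) < F n ∧ a (Nat.pair n v) = true := ⟨g n, hg n, (ha _ _).2 rfl⟩
  rw [decoded, dif_pos h]
  exact ((ha _ _).1 (Nat.find_spec h).2).symm

theorem decoded_congr {F : ℕ → ℕ∞} {a a' : ℕ → Bool} {n : ℕ}
    (h : ∀ v : ℕ, (v : ℕ∞) < F n → a' (Nat.pair n v) = a (Nat.pair n v)) :
    decoded F a' n = decoded F a n := by
  classical
  have (v : ℕ) : ((v : ℕ∞) < F n ∧ a' (Nat.pair n v) = true) ↔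
      ((v : ℕ∞) < F n ∧ a (Nat.pair n v) = true) :=
    and_congr_right fun hv => by rw [h v hv]
  unfold decoded
  split_ifs with h₁ h₂ h₂
  · exact Nat.find_congr' (this _)
  · exact absurd ((exists_congr this).1 h₁) h₂
  · exact absurd ((exists_congr this).2 h₂) h₁
  · rfl

theorem eventually_decoded_eq {F : ℕ → ℕ∞} {n : ℕ} (hn : F n < ⊤) (x : ℕ → Bool) :
    ∀ᶠ x' in 𝓝 x, decoded F (evens x') n = decoded F (evens x) n := by
  lift F n to ℕ using hn.ne with N hN
  have : ∀ᶠ x' in 𝓝 x, ∀ v ∈ Finset.range N,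
      evens x' (Nat.pair n v) = evens x (Nat.pair n v) :=
    (eventually_all_finset _).2 fun v _ => eventually_apply_eq x _
  filter_upwards [this] with x' hx'
  refine decoded_congr fun v hv => hx' v ?_
  rw [← hN] at hv
  simpa using hv

/-- A coding of prefixes of points of Cantor space by numbers below `F`: `code x n` codes the
prefix of `x` of length `len n`. -/
structure PrefixCoding (F : ℕ → ℕ∞) where
  /-- The length of the prefix coded at `n`. -/
  len : ℕ → ℕ
  /-- The code of a prefix. -/
  code : (ℕ → Bool) → ℕ → ℕ
  finite_len_le (m : ℕ) : {n | len n ≤ m}.Finite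
  code_lt (x : ℕ → Bool) (n : ℕ) : (code x n : ℕ∞) < F n
  code_eq_iff {x x' : ℕ → Bool} {n : ℕ} : code x n = code x' n ↔ ∀ i < len n, x i = x' i

theorem exists_prefixCoding {F : ℕ → ℕ∞} (h1 : ∀ n, 1 ≤ F n)
    (htop : ∀ m : ℕ, ∀ᶠ n in atTop, (m : ℕ∞) < F n) : Nonempty (PrefixCoding F) := by
  classical
  let len : ℕ → ℕ := fun n => Nat.findGreatest (fun j => ((2 ^ j : ℕ) : ℕ∞) ≤ F n) n
  have hlen : ∀ n, ((2 ^ len n : ℕ) : ℕ∞) ≤ F n := fun n =>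
    Nat.findGreatest_spec (P := fun j => ((2 ^ j : ℕ) : ℕ∞) ≤ F n) (Nat.zero_le n)
      (by simpa using h1 n)
  refine ⟨⟨len, fun x n => Fintype.equivFin (Fin (len n) → Bool) fun i => x i,
    fun m => ?_, fun x n => ?_, fun {x x' n} => ?_⟩⟩
  · have : ∀ᶠ n in atTop, ¬ len n ≤ m := by
      filter_upwards [htop (2 ^ (m + 1)), eventually_ge_atTop (m + 1)] with n hn hmn
      exact not_le.2 (Nat.le_findGreatest hmn hn.le)
    rw [← Nat.cofinite_eq_atTop, eventually_cofinite] at this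
    simpa using this
  · refine lt_of_lt_of_le ?_ (hlen n)
    have := (Fintype.equivFin (Fin (len n) → Bool) fun i => x i).isLt
    simp only [Fintype.card_pi, Fintype.card_bool, Finset.prod_const, Finset.card_univ,
      Fintype.card_fin] at this
    exact_mod_cast this
  · rw [Fin.val_inj, (Fintype.equivFin _).apply_eq_iff_eq, funext_iff]
    exact ⟨fun h i hi => h ⟨i, hi⟩, fun h i => h i i.2⟩

namespace PrefixCoding

variable {F : ℕ → ℕ∞} (C : PrefixCoding F) (slot : {n | F n < ⊤} ≃ List Bool)

theorem finite_code_eq {x x' : ℕ → Bool} (h : x ≠ x') :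
    {n | C.code x n = C.code x' n}.Finite := by
  obtain ⟨i, hi⟩ := Function.ne_iff.1 h
  refine (C.finite_len_le i).subset fun n hn => ?_
  by_contra hlt
  exact hi (C.code_eq_iff.1 hn i (not_le.1 hlt))

theorem eventually_code_eq (x : ℕ → Bool) (n : ℕ) :
    ∀ᶠ x' in 𝓝 x, C.code x' n = C.code x n := by
  have : ∀ᶠ x' in 𝓝 x, ∀ i ∈ Finset.range (C.len n), x' i = x i :=
    (eventually_all_finset _).2 fun i _ => eventually_apply_eq x i
  filter_upwards [this] with x' hx'
  exact C.code_eq_iff.2 fun i hi => hx' i (Finset.mem_range.2 hi)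

/-- A point whose prefix has code `v` at `n`, if there is one. -/
noncomputable def point (n v : ℕ) : ℕ → Bool := by
  classical exact if h : ∃ x, C.code x n = v then h.choose else fun _ => false

theorem point_apply {x : ℕ → Bool} {n v i : ℕ} (h : C.code x n = v) (hi : i < C.len n) :
    C.point n v i = x i := by
  have h' : ∃ x, C.code x n = v := ⟨x, h⟩
  rw [point, dif_pos h']
  exact C.code_eq_iff.1 (h'.choose_spec.trans h.symm) i hi

/-- The places attached to `a`, those whose label is a prefix of `a`. -/
def places (a : ℕ → Bool) : Set ℕ :=
  {n | ∃ h : F n < ⊤, slot ⟨n, h⟩ = (List.range (slot ⟨n, h⟩).length).map a}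

theorem infinite_places (a : ℕ → Bool) : (places slot a).Infinite := by
  refine Set.infinite_of_injective_forall_mem
    (f := fun l : ℕ => (slot.symm ((List.range l).map a) : ℕ)) (fun l l' h => ?_) fun l => ?_
  · simpa using congrArg List.length (slot.symm.injective (Subtype.ext h))
  · exact ⟨(slot.symm ((List.range l).map a)).2, by simp⟩

theorem finite_places_inter {a a' : ℕ → Bool} (h : a ≠ a') :
    (places slot a ∩ places slot a').Finite := by
  obtain ⟨i, hi⟩ := Function.ne_iff.1 h
  refine ((Set.finite_le_nat i).image
    fun l : ℕ => (slot.symm ((List.range l).map a) : ℕ)).subset ?_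
  rintro n ⟨⟨hn, h₁⟩, _, h₂⟩
  refine ⟨(slot ⟨n, hn⟩).length, ?_, by simp [← h₁]⟩
  by_contra hlt
  exact hi (List.map_inj_left.1 (h₁.symm.trans h₂) i (List.mem_range.2 (not_le.1 hlt)))

theorem eventually_mem_places (x : ℕ → Bool) (n : ℕ) :
    ∀ᶠ x' in 𝓝 x, (n ∈ places slot (evens x') ↔ n ∈ places slot (evens x)) := by
  by_cases hn : F n < ⊤
  · have : ∀ᶠ x' in 𝓝 x, ∀ i ∈ Finset.range (slot ⟨n, hn⟩).length, evens x' i = evens x i :=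
      (eventually_all_finset _).2 fun i _ => eventually_apply_eq x _
    filter_upwards [this] with x' hx'
    have : (List.range (slot ⟨n, hn⟩).length).map (evens x') =
        (List.range (slot ⟨n, hn⟩).length).map (evens x) :=
      List.map_congr_left fun i hi => hx' i (by simpa using hi)
    simp [places, hn, this]
  · simp [places, hn]

/-- `n` is a place attached to `evens x` at which the named function does not code a prefix of
`odds x`. -/
def Candidate (x : ℕ → Bool) (n : ℕ) : Prop :=
  n ∈ places slot (evens x) ∧ decoded F (evens x) n ≠ C.code (odds x) n

/-- How close the point coded by the named function at `n` is to `odds x`. -/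
noncomputable def closeness (x : ℕ → Bool) (n : ℕ) : ℕ :=
  agreement (C.point n (decoded F (evens x) n)) (odds x) n

/-- `n` is a candidate closer than all the earlier ones. -/
def Record (x : ℕ → Bool) (n : ℕ) : Prop :=
  C.Candidate slot x n ∧ ∀ m < n, C.Candidate slot x m → C.closeness x m < C.closeness x n

/-- The member of the family with parameter `x`. -/
noncomputable def member (x : ℕ → Bool) (n : ℕ) : ℕ := by
  classical exact if C.Record slot x n then decoded F (evens x) n else C.code x n

variable {C slot}

theorem member_of_record {x : ℕ → Bool} {n : ℕ} (h : C.Record slot x n) :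
    C.member slot x n = decoded F (evens x) n := if_pos h

theorem member_of_not_record {x : ℕ → Bool} {n : ℕ} (h : ¬ C.Record slot x n) :
    C.member slot x n = C.code x n := if_neg h

theorem member_mem_NF (h1 : ∀ n, 1 ≤ F n) (x : ℕ → Bool) : C.member slot x ∈ NF F := by
  intro n
  by_cases h : C.Record slot x n
  · rw [member_of_record h]
    exact decoded_lt h1 _ n
  · rw [member_of_not_record h]
    exact C.code_lt x n

theorem eventually_candidate_iff (x : ℕ → Bool) (n : ℕ) :
    ∀ᶠ x' in 𝓝 x, (C.Candidate slot x' n ↔ C.Candidate slot x n) := by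
  by_cases hn : F n < ⊤
  · have hodds : Continuous odds := continuous_pi fun i => continuous_apply _
    filter_upwards [eventually_mem_places slot x n, eventually_decoded_eq hn x,
      hodds.continuousAt.eventually (C.eventually_code_eq (odds x) n)] with x' h₁ h₂ h₃
    rw [Candidate, Candidate, h₁, h₂, h₃]
  · simp [Candidate, places, hn]

theorem eventually_closeness_eq {n : ℕ} (hn : F n < ⊤) (x : ℕ → Bool) :
    ∀ᶠ x' in 𝓝 x, C.closeness x' n = C.closeness x n := by
  have : ∀ᶠ x' in 𝓝 x, ∀ i ∈ Finset.range n, odds x' i = odds x i :=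
    (eventually_all_finset _).2 fun i _ => eventually_apply_eq x _
  filter_upwards [eventually_decoded_eq hn x, this] with x' h₁ h₂
  rw [closeness, closeness, h₁]
  exact agreement_congr fun i hi => h₂ i (Finset.mem_range.2 hi)

theorem Candidate.lt_top {x : ℕ → Bool} {n : ℕ} (h : C.Candidate slot x n) : F n < ⊤ := h.1.1

theorem eventually_record_iff (x : ℕ → Bool) (n : ℕ) :
    ∀ᶠ x' in 𝓝 x, (C.Record slot x' n ↔ C.Record slot x n) := by
  by_cases hn : F n < ⊤
  · have h : ∀ᶠ x' in 𝓝 x, ∀ m ∈ Finset.range n, ((C.Candidate slot x' m →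
        C.closeness x' m < C.closeness x' n) ↔ (C.Candidate slot x m →
        C.closeness x m < C.closeness x n)) := by
      refine (eventually_all_finset _).2 fun m _ => ?_
      by_cases hm : F m < ⊤
      · filter_upwards [eventually_candidate_iff (C := C) (slot := slot) x m,
          eventually_closeness_eq (C := C) hm x, eventually_closeness_eq (C := C) hn x]
          with x' h₁ h₂ h₃
        rw [h₁, h₂, h₃]
      · exact Eventually.of_forall fun x' =>
          iff_of_true (fun h => absurd h.lt_top hm) fun h => absurd h.lt_top hm
    filter_upwards [eventually_candidate_iff (C := C) (slot := slot) x n, h] with x' h₁ h₂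
    exact and_congr h₁ (forall₂_congr fun m hm => h₂ m (Finset.mem_range.2 hm))
  · exact Eventually.of_forall fun x' =>
      iff_of_false (fun h => hn h.1.lt_top) fun h => hn h.1.lt_top

theorem continuous_member : Continuous (C.member slot) := by
  refine continuous_pi fun n => ?_
  refine ((IsLocallyConstant.iff_eventually_eq _).2 fun x => ?_).continuous
  by_cases h : C.Record slot x n
  · filter_upwards [eventually_record_iff (C := C) (slot := slot) x n,
      eventually_decoded_eq h.1.lt_top x] with x' h₁ h₂
    rw [member_of_record h, member_of_record (h₁.2 h), h₂]
  · filter_upwards [eventually_record_iff (C := C) (slot := slot) x n,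
      C.eventually_code_eq x n] with x' h₁ h₂
    rw [member_of_not_record h, member_of_not_record (h₁.not.2 h), h₂]

theorem finite_record_closeness_le (x : ℕ → Bool) (i : ℕ) :
    {n | C.Record slot x n ∧ C.closeness x n ≤ i}.Finite := by
  refine Set.Finite.of_injOn (f := C.closeness x) (t := Set.Iic i) (fun n hn => hn.2) ?_
    (Set.finite_Iic i)
  intro m hm n hn hmn
  rcases lt_trichotomy m n with h | h | h
  · exact absurd hmn (hn.1.2 m h hm.1.1).ne
  · exact h
  · exact absurd hmn (hm.1.2 n h hn.1.1).ne'

theorem finite_record_decoded_eq_code (x x' : ℕ → Bool) :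
    {n | C.Record slot x n ∧ decoded F (evens x) n = C.code x' n}.Finite := by
  by_cases h : x' = odds x
  · subst h
    exact Set.finite_empty.subset fun n hn => hn.1.1.2 hn.2
  · obtain ⟨i, hi⟩ := Function.ne_iff.1 h
    refine ((finite_record_closeness_le (C := C) (slot := slot) x i).union
      (C.finite_len_le i)).subset fun n hn => ?_
    by_cases hin : C.len n ≤ i
    · exact Or.inr hin
    · refine Or.inl ⟨hn.1, agreement_le_of_ne ?_ n⟩
      rwa [C.point_apply hn.2.symm (not_le.1 hin)]

theorem finite_record_and_record {x x' : ℕ → Bool} (h : x ≠ x') :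
    {n | C.Record slot x n ∧ C.Record slot x' n}.Finite := by
  by_cases he : evens x = evens x'
  · obtain ⟨i, hi⟩ := Function.ne_iff.1 fun ho => h (eq_of_evens_eq_of_odds_eq he ho)
    refine ((finite_record_closeness_le (C := C) (slot := slot) x i).union
      (finite_record_closeness_le (C := C) (slot := slot) x' i)).subset fun n hn => ?_
    by_cases hp : C.point n (decoded F (evens x) n) i = odds x i
    · refine Or.inr ⟨hn.2, agreement_le_of_ne ?_ n⟩
      rwa [← he, hp]
    · exact Or.inl ⟨hn.1, agreement_le_of_ne hp n⟩
  · exact (finite_places_inter slot he).subset fun n hn => ⟨hn.1.1.1, hn.2.1.1⟩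

theorem evDiff_member {x x' : ℕ → Bool} (h : x ≠ x') :
    EvDiff (C.member slot x) (C.member slot x') := by
  refine (((C.finite_code_eq h).union (finite_record_and_record (C := C) (slot := slot) h)).union
    ((finite_record_decoded_eq_code (C := C) (slot := slot) x x').union
      (finite_record_decoded_eq_code (C := C) (slot := slot) x' x))).subset fun n hn => ?_
  rw [Set.mem_ofPred_eq] at hn
  by_cases hx : C.Record slot x n <;> by_cases hx' : C.Record slot x' n
  · exact Or.inl (Or.inr ⟨hx, hx'⟩)
  · rw [member_of_record hx, member_of_not_record hx'] at hn
    exact Or.inr (Or.inl ⟨hx, hn⟩)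
  · rw [member_of_not_record hx, member_of_record hx'] at hn
    exact Or.inr (Or.inr ⟨hx', hn.symm⟩)
  · rw [member_of_not_record hx, member_of_not_record hx'] at hn
    exact Or.inl (Or.inl hn)

theorem member_injective : Function.Injective (C.member slot) := by
  intro x x' hxx'
  by_contra h
  have := evDiff_member (C := C) (slot := slot) h
  rw [EvDiff, hxx'] at this
  exact Set.infinite_univ (this.subset fun n _ => rfl)

theorem infinite_record {x : ℕ → Bool}
    (h : ∀ l, ∃ n, C.Candidate slot x n ∧ l ≤ C.closeness x n) :
    {n | C.Record slot x n}.Infinite := by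
  classical
  refine Set.infinite_of_forall_exists_gt fun N => ?_
  obtain ⟨l, hl⟩ : ∃ l, ∀ m ≤ N, C.closeness x m < l := by
    refine ⟨(Finset.range (N + 1)).sup (C.closeness x) + 1, fun m hm => ?_⟩
    exact Nat.lt_succ_of_le (Finset.le_sup (Finset.mem_range.2 (Nat.lt_succ_of_le hm)))
  refine ⟨Nat.find (h l), ⟨(Nat.find_spec (h l)).1, fun m hm hc => ?_⟩, ?_⟩
  · have := Nat.find_min (h l) hm
    exact (not_le.1 fun hle => this ⟨hc, hle⟩).trans_le (Nat.find_spec (h l)).2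
  · by_contra! hle
    exact absurd (Nat.find_spec (h l)).2 (not_le.2 (hl _ hle))

variable (C slot)

theorem exists_infinite_member_eq {g : ℕ → ℕ} (hg : g ∈ NF F) :
    ∃ x, {n | C.member slot x n = g n}.Infinite := by
  obtain ⟨a, ha⟩ := exists_decoded_eq hg
  by_cases hA : ∃ z, {n | n ∈ places slot a ∧ C.code z n = g n}.Infinite
  · obtain ⟨z, hz⟩ := hA
    refine ⟨z, ?_⟩
    by_cases hza : evens z = a
    · refine hz.mono fun n hn => ?_
      by_cases hr : C.Record slot z n
      · rw [Set.mem_ofPred_eq, member_of_record hr, hza, ha]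
      · exact (member_of_not_record hr).trans hn.2
    · refine (hz.sdiff (finite_places_inter slot hza)).mono fun n hn => ?_
      exact (member_of_not_record fun hr => hn.2 ⟨hr.1.1, hn.1.1⟩).trans hn.1.2
  · push Not at hA
    have : (cofinite ⊓ 𝓟 (places slot a)).NeBot :=
      (infinite_places slot a).cofinite_inf_principal_neBot
    obtain ⟨y, hy⟩ := exists_clusterPt_of_compactSpace
      (map (fun n => C.point n (g n)) (cofinite ⊓ 𝓟 (places slot a)))
    have hy : MapClusterPt y (cofinite ⊓ 𝓟 (places slot a)) fun n => C.point n (g n) := hy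
    refine ⟨interleave a y, (infinite_record (C := C) (slot := slot) (x := interleave a y)
      fun l => ?_).mono fun n hn => ?_⟩
    · have h₁ : ∀ᶠ u in 𝓝 y, ∀ i ∈ Finset.range l, u i = y i :=
        (eventually_all_finset _).2 fun i _ => eventually_apply_eq y i
      have h₂ : ∀ᶠ n in cofinite ⊓ 𝓟 (places slot a), n ∈ places slot a :=
        mem_inf_of_right (mem_principal_self _)
      have h₃ : ∀ᶠ n in cofinite ⊓ 𝓟 (places slot a),
          ¬ (n ∈ places slot a ∧ C.code y n = g n) :=
        Eventually.filter_mono inf_le_left (eventually_cofinite.2 (by simpa using hA y))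
      have h₄ : ∀ᶠ n in cofinite ⊓ 𝓟 (places slot a), l ≤ n :=
        Eventually.filter_mono inf_le_left
          (by rw [Nat.cofinite_eq_atTop]; exact eventually_ge_atTop l)
      obtain ⟨n, hn₁, hn₂, hn₃, hn₄⟩ :=
        ((mapClusterPt_iff_frequently.1 hy _ h₁).and_eventually (h₂.and (h₃.and h₄))).exists
      refine ⟨n, ⟨by simpa using hn₂, ?_⟩, le_agreement hn₄ fun i hi => ?_⟩
      · simpa [ha] using fun h : g n = C.code y n => hn₃ ⟨hn₂, h.symm⟩
      · simpa [ha] using hn₁ i (Finset.mem_range.2 hi)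
    · rw [Set.mem_ofPred_eq, member_of_record hn, evens_interleave, ha]

theorem isMEDF_range_member (h1 : ∀ n, 1 ≤ F n) : IsMEDF F (Set.range (C.member slot)) := by
  refine ⟨⟨?_, ?_⟩, fun E' hE' hsub => (Set.Subset.antisymm hsub fun g hg => ?_).symm⟩
  · rintro _ ⟨x, rfl⟩
    exact member_mem_NF h1 x
  · rintro _ ⟨x, rfl⟩ _ ⟨x', rfl⟩ hne
    exact evDiff_member fun h => hne (by rw [h])
  · obtain ⟨x, hx⟩ := C.exists_infinite_member_eq slot (hE'.1 hg)
    by_contra hnot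
    exact hx (hE'.2 _ (hsub ⟨x, rfl⟩) g hg fun h => hnot ⟨x, h⟩)

end PrefixCoding

theorem frequently_ne (x : ℕ → Bool) : ∃ᶠ x' in 𝓝 x, x' ≠ x := by
  have ht : Tendsto (fun n => Function.update x n (!x n)) atTop (𝓝 x) := by
    refine tendsto_pi_nhds.2 fun i => tendsto_const_nhds.congr' ?_
    filter_upwards [eventually_gt_atTop i] with n hn
    rw [Function.update_of_ne hn.ne]
  refine ht.frequently (Eventually.of_forall fun n h => ?_).frequently
  simpa using congrFun h n

theorem perfect_range {f : (ℕ → Bool) → ℕ → ℕ} (hf : Continuous f)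
    (hinj : Function.Injective f) : Perfect (Set.range f) := by
  refine ⟨(isCompact_range hf).isClosed, ?_⟩
  rintro _ ⟨x, rfl⟩
  refine accPt_iff_frequently.2 (hf.continuousAt.tendsto.frequently ?_)
  exact (frequently_ne x).mono fun x' hx' => ⟨hinj.ne hx', x', rfl⟩

end EventuallyDifferent

theorem stmt16 (F : ℕ → ℕ∞) (h1 : ∀ n, 1 ≤ F n)
    (hD : {n : ℕ | F n < ⊤}.Infinite)
    (htop : ∀ m : ℕ, ∀ᶠ n in Filter.atTop, (m : ℕ∞) < F n) :
    ∃ E : Set (ℕ → ℕ), IsMEDF F E ∧ IsCompact E ∧ Perfect E ∧ E.Nonempty := by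
  obtain ⟨C⟩ := EventuallyDifferent.exists_prefixCoding h1 htop
  have := hD.to_subtype
  obtain ⟨slot⟩ : Nonempty ({n | F n < ⊤} ≃ List Bool) := nonempty_equiv_of_countable
  exact ⟨Set.range (C.member slot), C.isMEDF_range_member slot h1,
    isCompact_range EventuallyDifferent.PrefixCoding.continuous_member,
    EventuallyDifferent.perfect_range EventuallyDifferent.PrefixCoding.continuous_member
      EventuallyDifferent.PrefixCoding.member_injective, Set.range_nonempty _⟩
end
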